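/- Let (R, m, k) be a Noetherian local ring of characteristic 2 and Krull dimension d, and let P be a complex of finite rank free R-modules of the form 0 → P_{d+1} → P_d → ⋯ → P_1 → P_0 → 0 (concentrated in homological degrees 0 through d+1) whose homology is nonzero and of finite length in every degree. Then the total rank ∑_{j=0}^{d+1} rank_R(P_j) is at least 2^d. -/

import Mathlib

open CategoryTheory

section RelativeLength

variable {R N N' : Type*} [CommRing R] [AddCommGroup N] [Module R N] [AddCommGroup N'] [Module R N']

/-- The length of `A / (A ⊓ B)`. -/
noncomputable def relLength (A B : Submodule R N) : ℕ∞ := Module.length R (A ⧸ B.submoduleOf A)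

theorem Submodule.mapQ_injective_of_eq_comap {p : Submodule R N} {q : Submodule R N'}
    (f : N →ₗ[R] N') (h : p = q.comap f) : Function.Injective (p.mapQ q f h.le) := by
  rw [← LinearMap.ker_eq_bot, Submodule.ker_mapQ, ← h, Submodule.mkQ_map_self]

theorem relLength_le_of_inj {A B : Submodule R N} {A' B' : Submodule R N'} (f : N →ₗ[R] N')
    (hA : ∀ x ∈ A, f x ∈ A') (hB : ∀ x ∈ A, f x ∈ B' → x ∈ B) :
    relLength A B ≤ relLength A' B' := by
  let φ : A →ₗ[R] A' := f.restrict hA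
  have h1 : (B'.submoduleOf A').comap φ ≤ B.submoduleOf A := fun x hx => hB x x.2 hx
  let i : (A ⧸ (B'.submoduleOf A').comap φ) →ₗ[R] (A' ⧸ B'.submoduleOf A') :=
    Submodule.mapQ _ _ φ le_rfl
  refine le_trans (Module.length_le_of_surjective (Submodule.factor h1)
    (Submodule.factor_surjective h1)) (Module.length_le_of_injective i
      (Submodule.mapQ_injective_of_eq_comap φ rfl))

theorem relLength_le_of_surj {A B : Submodule R N} {A' B' : Submodule R N'} (g : N' →ₗ[R] N)
    (hA : ∀ x ∈ A, ∃ y ∈ A', g y - x ∈ B) (hB : ∀ y ∈ A', y ∈ B' → g y ∈ B) :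
    relLength A B ≤ relLength A' B' := by
  let i : (A ⧸ B.submoduleOf A) →ₗ[R] (N ⧸ B) := Submodule.mapQ _ _ A.subtype le_rfl
  have hi : Function.Injective i := Submodule.mapQ_injective_of_eq_comap _ rfl
  let j : (A' ⧸ B'.submoduleOf A') →ₗ[R] (N ⧸ B) :=
    Submodule.mapQ _ _ (g ∘ₗ A'.subtype) (fun y hy => hB y y.2 hy)
  have hr : LinearMap.range i ≤ LinearMap.range j := by
    rintro _ ⟨x, rfl⟩
    obtain ⟨x, rfl⟩ := Submodule.mkQ_surjective _ x
    obtain ⟨y, hy, hxy⟩ := hA x x.2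
    exact ⟨Submodule.Quotient.mk ⟨y, hy⟩, (Submodule.Quotient.eq B).2 hxy⟩
  calc relLength A B ≤ Module.length R (LinearMap.range j) :=
        Module.length_le_of_injective (LinearMap.codRestrict (LinearMap.range j) i
          fun x => hr ⟨x, rfl⟩) fun x y h => hi (congrArg Subtype.val h)
    _ ≤ relLength A' B' :=
        Module.length_le_of_surjective j.rangeRestrict j.surjective_rangeRestrict

theorem relLength_add {A B C : Submodule R N} (hBC : B ≤ C) (hCA : C ≤ A) :
    relLength A B = relLength C B + relLength A C := by
  refine Module.length_eq_add_of_exact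
    (Submodule.mapQ (B.submoduleOf C) (B.submoduleOf A) (Submodule.inclusion hCA) le_rfl)
    (Submodule.mapQ (B.submoduleOf A) (C.submoduleOf A) LinearMap.id (Submodule.comap_mono hBC))
    (Submodule.mapQ_injective_of_eq_comap (p := B.submoduleOf C) (q := B.submoduleOf A)
      (Submodule.inclusion hCA) rfl) ?_ ?_
  · intro x
    obtain ⟨x, rfl⟩ := Submodule.mkQ_surjective _ x
    exact ⟨Submodule.Quotient.mk x, rfl⟩
  · intro x
    obtain ⟨x, rfl⟩ := Submodule.mkQ_surjective _ x
    constructor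
    · intro h
      have hx : (x : N) ∈ C := (Submodule.Quotient.mk_eq_zero (C.submoduleOf A)).1 h
      exact ⟨Submodule.Quotient.mk ⟨x, hx⟩, rfl⟩
    · rintro ⟨y, hy⟩
      obtain ⟨y, rfl⟩ := Submodule.mkQ_surjective _ y
      have h : (y : N) - x ∈ B := (Submodule.Quotient.eq (B.submoduleOf A)).1 hy
      refine (Submodule.Quotient.mk_eq_zero _).2 (show (x : N) ∈ C from ?_)
      simpa using C.sub_mem y.2 (hBC h)

theorem relLength_mono {A B A' B' : Submodule R N} (hA : A ≤ A') (hB : B' ≤ B) :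
    relLength A B ≤ relLength A' B' :=
  relLength_le_of_surj LinearMap.id (fun x hx => ⟨x, hA hx, by simp⟩) fun _ _ h => hB h

theorem relLength_inf_right (A B : Submodule R N) : relLength A (A ⊓ B) = relLength A B := by
  unfold relLength
  rw [Submodule.submoduleOf, Submodule.comap_inf, Submodule.comap_subtype_self, top_inf_eq]
  rfl

theorem relLength_le_add (A B C : Submodule R N) :
    relLength A B ≤ relLength (A ⊓ C) B + relLength A C := by
  have h : relLength (A ⊓ C ⊔ A ⊓ B) (A ⊓ B) ≤ relLength (A ⊓ C) B := by
    refine relLength_le_of_surj LinearMap.id ?_ fun y hy h => ⟨hy.1, h⟩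
    intro x hx
    obtain ⟨c, hc, b, hb, rfl⟩ := Submodule.mem_sup.1 hx
    exact ⟨c, hc, by simpa using hb⟩
  rw [← relLength_inf_right A B,
    relLength_add (C := A ⊓ C ⊔ A ⊓ B) le_sup_right (sup_le inf_le_left inf_le_left)]
  gcongr
  rw [← relLength_inf_right A C]
  exact relLength_mono le_rfl le_sup_left

theorem relLength_eq_zero {A B : Submodule R N} (h : A ≤ B) : relLength A B = 0 := by
  unfold relLength
  rw [Module.length_eq_zero_iff, Submodule.Quotient.subsingleton_iff]
  exact Submodule.comap_subtype_eq_top.2 h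

theorem relLength_le_length (A B : Submodule R N) : relLength A B ≤ Module.length R N :=
  (Module.length_le_of_surjective _ (Submodule.mkQ_surjective (B.submoduleOf A))).trans
    (Module.length_le_of_injective A.subtype A.subtype_injective)

/-- The length of a step-by-step filtration is bounded by the sum of the bounds for its steps. -/
theorem relLength_le_sum (X : ℕ → Submodule R N) (c : ℕ → ℕ∞)
    (hc : ∀ w, relLength (X (w + 1)) (X w) ≤ c w) (n : ℕ) :
    relLength (X n) (X 0) ≤ ∑ w ∈ Finset.range n, c w := by
  induction n with
  | zero => simp [relLength_eq_zero]
  | succ n ih =>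
    rw [Finset.sum_range_succ]
    refine (relLength_le_add (X (n + 1)) (X 0) (X n)).trans (add_le_add ?_ (hc n))
    exact (relLength_mono inf_le_right le_rfl).trans ih

end RelativeLength

section GradedComplex

variable {R I : Type*} [CommRing R] [Fintype I]

/-- The action of a square matrix over `R` on vectors with entries in an `R`-module. -/
def Matrix.act (A : Matrix I I R) (M : Type*) [AddCommGroup M] [Module R M] :
    (I → M) →ₗ[R] (I → M) :=
  LinearMap.pi fun a => ∑ b, A a b • LinearMap.proj b

/-- The matrix of the differential of a complex of free modules with a homogeneous basis. -/
structure IsGradedDiff (deg : I → ℕ) (A : Matrix I I R) : Prop where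
  sq : A * A = 0
  deg_eq : ∀ a b, A a b ≠ 0 → deg b = deg a + 1

/-- Vectors supported in degree `k`. -/
def homogeneous (R : Type*) [CommRing R] (deg : I → ℕ) (M : Type*) [AddCommGroup M] [Module R M]
    (k : ℕ) : Submodule R (I → M) where
  carrier := {v | ∀ a, deg a ≠ k → v a = 0}
  add_mem' := fun hv hw a ha => by simp [hv a ha, hw a ha]
  zero_mem' := fun _ _ => rfl
  smul_mem' := fun r v hv a ha => by simp [hv a ha]

/-- Homogeneous cycles of degree `k`. -/
def gradedCycles (deg : I → ℕ) (A : Matrix I I R) (M : Type*) [AddCommGroup M] [Module R M]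
    (k : ℕ) : Submodule R (I → M) :=
  homogeneous R deg M k ⊓ LinearMap.ker (A.act M)

/-- Homogeneous boundaries of degree `k`. -/
def gradedBoundaries (deg : I → ℕ) (A : Matrix I I R) (M : Type*) [AddCommGroup M] [Module R M]
    (k : ℕ) : Submodule R (I → M) :=
  (homogeneous R deg M (k + 1)).map (A.act M)

/-- The length of the homology in degree `k`. -/
noncomputable def homologyLength (deg : I → ℕ) (A : Matrix I I R) (M : Type*) [AddCommGroup M]
    [Module R M] (k : ℕ) : ℕ∞ :=
  relLength (gradedCycles deg A M k) (gradedBoundaries deg A M k)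

variable {deg : I → ℕ} {A : Matrix I I R} {M : Type*} [AddCommGroup M] [Module R M]

theorem Matrix.act_apply (v : I → M) (a : I) : A.act M v a = ∑ b, A a b • v b := by
  simp [Matrix.act]

theorem Matrix.act_mul_apply (A B : Matrix I I R) (v : I → M) :
    (A * B).act M v = A.act M (B.act M v) := by
  ext a
  simp only [Matrix.act_apply, Matrix.mul_apply, Finset.sum_smul, Finset.smul_sum, mul_smul]
  exact Finset.sum_comm

theorem Matrix.act_add_apply (A B : Matrix I I R) (v : I → M) :
    (A + B).act M v = A.act M v + B.act M v := by
  ext a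
  simp [Matrix.act_apply, add_smul, Finset.sum_add_distrib]

theorem IsGradedDiff.act_act (hA : IsGradedDiff deg A) (v : I → M) :
    A.act M (A.act M v) = 0 := by
  rw [← Matrix.act_mul_apply, hA.sq]
  ext a
  simp [Matrix.act_apply]

theorem IsGradedDiff.act_mem_homogeneous (hA : IsGradedDiff deg A) {k : ℕ} {v : I → M}
    (hv : v ∈ homogeneous R deg M (k + 1)) : A.act M v ∈ homogeneous R deg M k := by
  intro a ha
  rw [Matrix.act_apply]
  refine Finset.sum_eq_zero fun b _ => ?_
  by_cases h : A a b = 0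
  · simp [h]
  · rw [hv b (by have := hA.deg_eq a b h; omega), smul_zero]

theorem IsGradedDiff.boundaries_le_cycles (hA : IsGradedDiff deg A) (k : ℕ) :
    gradedBoundaries deg A M k ≤ gradedCycles deg A M k := by
  rintro _ ⟨v, hv, rfl⟩
  exact ⟨hA.act_mem_homogeneous hv, hA.act_act v⟩

theorem IsGradedDiff.map {S : Type*} [CommRing S] (hA : IsGradedDiff deg A) (f : R →+* S) :
    IsGradedDiff deg (A.map f) where
  sq := by rw [← Matrix.map_mul, hA.sq, Matrix.map_zero _ (map_zero f)]
  deg_eq a b h := hA.deg_eq a b fun h' => h (by simp [h'])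

theorem homologyLength_eq_zero {n k : ℕ} (hn : ∀ a, deg a ≤ n) (hk : n < k) :
    homologyLength deg A M k = 0 := by
  refine relLength_eq_zero fun v hv => ?_
  have : v = 0 := funext fun a => hv.1 a (by have := hn a; omega)
  exact this ▸ Submodule.zero_mem _

end GradedComplex

section TensorSquare

variable {R I : Type*} [CommRing R] [Fintype I]

/-- The differential on the tensor square twisted by the norm of the swap. An element of the tensor
square is the matrix of its coordinates. -/
def twistedDiff (A : Matrix I I R) : Matrix I I R →ₗ[R] Matrix I I R where
  toFun M := A * M + M * A.transpose + M + M.transpose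
  map_add' M N := by simp only [mul_add, add_mul, Matrix.transpose_add]; abel
  map_smul' r M := by simp [smul_add]

/-- Elements of the tensor square whose components of degree at least `n` vanish. -/
def degreeLT (R : Type*) [CommRing R] (deg : I → ℕ) (n : ℕ) : Submodule R (Matrix I I R) where
  carrier := {M | ∀ a b, n ≤ deg a + deg b → M a b = 0}
  add_mem' := fun hv hw a b ha => by simp [hv a b ha, hw a b ha]
  zero_mem' := fun _ _ _ => rfl
  smul_mem' := fun r v hv a b ha => by simp [hv a b ha]

/-- The coordinates of `e ⊗ e` for basis vectors `e` of degree `j`. -/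
def diagPart (R : Type*) [CommRing R] (deg : I → ℕ) (j : ℕ) : Matrix I I R →ₗ[R] (I → R) where
  toFun M b := if deg b = j then M b b else 0
  map_add' M N := by ext b; by_cases h : deg b = j <;> simp [h]
  map_smul' r M := by ext b; by_cases h : deg b = j <;> simp [h]

/-- The strictly upper triangular part of a matrix, for the order given by `idx`. -/
def upperPart (R : Type*) [CommRing R] (idx : I → ℕ) : Matrix I I R →ₗ[R] Matrix I I R where
  toFun M := Matrix.of fun a b => if idx a < idx b then M a b else 0
  map_add' M N := by ext a b; by_cases h : idx a < idx b <;> simp [h]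
  map_smul' r M := by ext a b; by_cases h : idx a < idx b <;> simp [h]

variable {deg : I → ℕ} {A : Matrix I I R} {idx : I → ℕ}

theorem twistedDiff_apply (A M : Matrix I I R) (a b : I) : twistedDiff A M a b =
    ∑ c, A a c * M c b + ∑ c, M a c * A b c + M a b + M b a := by
  simp [twistedDiff, Matrix.mul_apply]

omit [Fintype I] in
theorem diagPart_apply (M : Matrix I I R) (j : ℕ) (b : I) :
    diagPart R deg j M b = if deg b = j then M b b else 0 := rfl

omit [Fintype I] in
theorem upperPart_apply (M : Matrix I I R) (a b : I) :
    upperPart R idx M a b = if idx a < idx b then M a b else 0 := rfl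

omit [Fintype I] in
theorem degreeLT_mono {m n : ℕ} (h : m ≤ n) : degreeLT R deg m ≤ degreeLT R deg n :=
  fun _ hM a b hab => hM a b (h.trans hab)

theorem IsGradedDiff.left_eq_zero (hA : IsGradedDiff deg A) {M : Matrix I I R} {n : ℕ}
    (hM : M ∈ degreeLT R deg (n + 1)) {a b : I} (hab : n ≤ deg a + deg b) :
    ∑ c, A a c * M c b = 0 := by
  refine Finset.sum_eq_zero fun c _ => ?_
  by_cases h : A a c = 0
  · simp [h]
  · rw [hM c b (by have := hA.deg_eq a c h; omega), mul_zero]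

theorem IsGradedDiff.right_eq_zero (hA : IsGradedDiff deg A) {M : Matrix I I R} {n : ℕ}
    (hM : M ∈ degreeLT R deg (n + 1)) {a b : I} (hab : n ≤ deg a + deg b) :
    ∑ c, M a c * A b c = 0 := by
  refine Finset.sum_eq_zero fun c _ => ?_
  by_cases h : A b c = 0
  · simp [h]
  · rw [hM a c (by have := hA.deg_eq b c h; omega), zero_mul]

theorem IsGradedDiff.twistedDiff_apply_of_mem (hA : IsGradedDiff deg A) {M : Matrix I I R} {n : ℕ}
    (hM : M ∈ degreeLT R deg (n + 1)) {a b : I} (hab : n ≤ deg a + deg b) :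
    twistedDiff A M a b = M a b + M b a := by
  rw [twistedDiff_apply, hA.left_eq_zero hM hab, hA.right_eq_zero hM hab, zero_add, zero_add]

theorem sum_sum_eq_sum_diag [CharP R 2] (N : I → I → R) (hN : ∀ a b, N a b = N b a) :
    ∑ a, ∑ b, N a b = ∑ a, N a a := by
  classical
  rw [← Finset.sum_product', ← Finset.diag_union_offDiag,
    Finset.sum_union (Finset.disjoint_diag_offDiag _), Finset.sum_diag, add_eq_left]
  refine Finset.sum_involution (fun p _ => p.swap) ?_ ?_ ?_ ?_
  · rintro ⟨a, b⟩ _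
    simp [hN b a, CharTwo.add_self_eq_zero]
  · rintro ⟨a, b⟩ h _ h'
    simp only [Finset.mem_offDiag, Prod.swap_prod_mk, Prod.mk.injEq] at h h'
    exact h.2.2 h'.2
  · rintro ⟨a, b⟩ h
    simp only [Finset.mem_offDiag, Prod.swap_prod_mk] at h ⊢
    exact ⟨h.2.1, h.1, h.2.2.symm⟩
  · simp

variable [CharP R 2]

theorem twistedDiff_twistedDiff (hA : IsGradedDiff deg A) (M : Matrix I I R) :
    twistedDiff A (twistedDiff A M) = 0 := by
  have h2 (X : Matrix I I R) : X + X = 0 := by ext; simp [CharTwo.add_self_eq_zero]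
  have ht : A.transpose * A.transpose = 0 := by
    rw [← Matrix.transpose_mul, hA.sq, Matrix.transpose_zero]
  have h1 (X : Matrix I I R) : A * (A * X) = 0 := by rw [← mul_assoc, hA.sq, zero_mul]
  have h3 (X : Matrix I I R) : X * A.transpose * A.transpose = 0 := by
    rw [mul_assoc, ht, mul_zero]
  simp only [twistedDiff, LinearMap.coe_mk, AddHom.coe_mk, mul_add, add_mul,
    Matrix.transpose_add, Matrix.transpose_mul, Matrix.transpose_transpose, h1, h3]
  rw [← mul_assoc]
  linear_combination (norm := abel) h2 (A * M * A.transpose) + h2 (A * M) + h2 (M * A.transpose) +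
    h2 M + h2 M.transpose + h2 (A * M.transpose) + h2 (M.transpose * A.transpose)

/-- The leading terms of a lift of a Frobenius cycle to the twisted tensor square. -/
def tateLift [DecidableEq I] (A : Matrix I I R) : (I → R) →ₗ[R] Matrix I I R where
  toFun v := Matrix.diagonal v + Matrix.diagonal v * A.transpose
  map_add' v w := by
    rw [show Matrix.diagonal (v + w) = Matrix.diagonal v + Matrix.diagonal w from
      (Matrix.diagonal_add v w).symm]
    simp only [add_mul]; abel
  map_smul' r v := by simp [Matrix.diagonal_smul]

variable [DecidableEq I]

theorem twistedDiff_tateLift (hA : IsGradedDiff deg A) (v : I → R) :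
    twistedDiff A (tateLift A v) = A * Matrix.diagonal v * A.transpose := by
  have h2 (X : Matrix I I R) : X + X = 0 := by ext; simp [CharTwo.add_self_eq_zero]
  have ht : A.transpose * A.transpose = 0 := by
    rw [← Matrix.transpose_mul, hA.sq, Matrix.transpose_zero]
  have h3 (X : Matrix I I R) : X * A.transpose * A.transpose = 0 := by
    rw [mul_assoc, ht, mul_zero]
  simp only [twistedDiff, tateLift, LinearMap.coe_mk, AddHom.coe_mk, mul_add, add_mul,
    Matrix.transpose_add, Matrix.transpose_mul, Matrix.transpose_transpose, h3,
    Matrix.diagonal_transpose, mul_assoc]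
  linear_combination (norm := abel) h2 (A * Matrix.diagonal v) + h2 (Matrix.diagonal v) +
    h2 (Matrix.diagonal v * A.transpose)

omit [CharP R 2] in
theorem conj_diagonal_apply (A : Matrix I I R) (v : I → R) (a b : I) :
    (A * Matrix.diagonal v * A.transpose) a b = ∑ c, A a c * v c * A b c := by
  simp [Matrix.mul_apply (M := A * Matrix.diagonal v), Matrix.mul_diagonal]

theorem conj_diagonal_diag (A : Matrix I I R) (v : I → R) (b : I) :
    (A * Matrix.diagonal v * A.transpose) b b = (A.map (frobenius R 2)).act R v b := by
  rw [conj_diagonal_apply, Matrix.act_apply]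
  refine Finset.sum_congr rfl fun c _ => ?_
  simp only [Matrix.map_apply, frobenius_def, smul_eq_mul]
  ring

omit [DecidableEq I] in
/-- The diagonal part of the twisted differential computes the Frobenius pullback. -/
theorem twistedDiff_diag (hA : IsGradedDiff deg A) {M : Matrix I I R} {j : ℕ}
    (hM : M ∈ degreeLT R deg (2 * j + 3)) (hDM : twistedDiff A M ∈ degreeLT R deg (2 * j + 1))
    {b : I} (hb : deg b = j) :
    twistedDiff A M b b = (A.map (frobenius R 2)).act R (diagPart R deg (j + 1) M) b := by
  have hsymm {a c : I} (hac : 2 * j + 2 ≤ deg a + deg c) : M a c = M c a := by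
    have h := hA.twistedDiff_apply_of_mem hM hac
    rw [hDM a c (by omega)] at h
    exact CharTwo.add_eq_zero.1 h.symm
  have hlow {c : I} (hc : deg c = j + 1) :
      M c b + M b c = (A * M) c b + (M * A.transpose) c b := by
    have h := twistedDiff_apply A M c b
    rw [hDM c b (by omega)] at h
    have h' : (A * M) c b + (M * A.transpose) c b + (M c b + M b c) = 0 := by
      simp only [Matrix.mul_apply, Matrix.transpose_apply]
      rw [h]; ring
    exact (CharTwo.add_eq_zero.1 h').symm
  calc twistedDiff A M b b = ∑ c, A b c * (M c b + M b c) := by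
        rw [twistedDiff_apply, add_assoc, CharTwo.add_self_eq_zero, add_zero,
          ← Finset.sum_add_distrib]
        exact Finset.sum_congr rfl fun c _ => by ring
    _ = ∑ c, A b c * ((A * M) c b + (M * A.transpose) c b) := by
        refine Finset.sum_congr rfl fun c _ => ?_
        by_cases h : A b c = 0
        · simp [h]
        · rw [hlow (by rw [hA.deg_eq b c h, hb])]
    _ = (A * (A * M) + A * (M * A.transpose)) b b := by
        simp only [Matrix.add_apply, Matrix.mul_apply (M := A) (N := A * M),
          Matrix.mul_apply (M := A) (N := M * A.transpose), mul_add, Finset.sum_add_distrib]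
    _ = ∑ c, ∑ a, A b c * M c a * A b a := by
        rw [← mul_assoc, hA.sq, zero_mul, zero_add, Matrix.mul_apply]
        simp [Matrix.mul_apply, Finset.mul_sum, mul_assoc]
    _ = ∑ c, A b c * M c c * A b c := by
        refine sum_sum_eq_sum_diag _ fun c a => ?_
        by_cases hc : A b c = 0
        · simp [hc]
        by_cases ha : A b a = 0
        · simp [ha]
        rw [hsymm (by have := hA.deg_eq _ _ hc; have := hA.deg_eq _ _ ha; omega)]
        ring
    _ = _ := by
        rw [Matrix.act_apply]
        refine Finset.sum_congr rfl fun c _ => ?_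
        by_cases hc : A b c = 0
        · simp [hc, frobenius_def]
        · rw [diagPart_apply, if_pos (by rw [hA.deg_eq _ _ hc, hb]), Matrix.map_apply,
            frobenius_def, smul_eq_mul]
          ring

omit [DecidableEq I] in
theorem exists_sub_twistedDiff_mem (hidx : Function.Injective idx) (hA : IsGradedDiff deg A)
    {M : Matrix I I R} {n : ℕ}
    (hM : M ∈ degreeLT R deg (n + 1)) (hDM : twistedDiff A M ∈ degreeLT R deg n)
    (hdiag : ∀ b, 2 * deg b = n → M b b = 0) :
    ∃ X, M - twistedDiff A X ∈ degreeLT R deg n := by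
  have hX : upperPart R idx M ∈ degreeLT R deg (n + 1) := fun a b hab => by
    simp [upperPart_apply, hM a b hab]
  refine ⟨upperPart R idx M, fun a b hab => ?_⟩
  have hs : M a b = M b a := by
    have h := hA.twistedDiff_apply_of_mem hM hab
    rw [hDM a b hab] at h
    exact CharTwo.add_eq_zero.1 h.symm
  rw [Matrix.sub_apply, hA.twistedDiff_apply_of_mem hX hab, upperPart_apply, upperPart_apply]
  rcases lt_trichotomy (idx a) (idx b) with h | h | h
  · simp [h, h.not_gt]
  · obtain rfl := hidx h
    by_cases h' : 2 * deg a = n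
    · simp [hdiag a h']
    · simp [hM a a (by omega)]
  · simp [h, h.not_gt, hs]

/-- Boundaries lying in degrees `< m` of elements of degrees `≤ 2 * k`. -/
def boundedBoundaries (deg : I → ℕ) (A : Matrix I I R) (m k : ℕ) : Submodule R (Matrix I I R) :=
  (degreeLT R deg (2 * k + 1) ⊓ (degreeLT R deg m).comap (twistedDiff A)).map (twistedDiff A)

theorem relLength_boundedBoundaries_le (hA : IsGradedDiff deg A) {m k : ℕ} (hm : m ≤ 2 * k) :
    relLength (boundedBoundaries deg A m (k + 1)) (boundedBoundaries deg A m k) ≤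
      homologyLength deg (A.map (frobenius R 2)) R (k + 1) := by
  obtain ⟨idx, hidx⟩ : ∃ idx : I → ℕ, Function.Injective idx :=
    ⟨fun a => Fintype.equivFin I a, fun a b h => (Fintype.equivFin I).injective (Fin.ext h)⟩
  refine (relLength_le_of_surj
    (A' := degreeLT R deg (2 * (k + 1) + 1) ⊓ (degreeLT R deg m).comap (twistedDiff A))
    (B' := (boundedBoundaries deg A m k).comap (twistedDiff A)) (twistedDiff A) ?_
    fun y _ h => h).trans (relLength_le_of_inj (diagPart R deg (k + 1)) ?_ ?_)
  · rintro _ ⟨y, hy, rfl⟩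
    exact ⟨y, hy, by simp⟩
  · rintro M ⟨hM, hDM⟩
    have hsupp : diagPart R deg (k + 1) M ∈ homogeneous R deg R (k + 1) := fun a ha => by
      simp [diagPart_apply, ha]
    refine ⟨hsupp, ?_⟩
    ext b
    by_cases hb : deg b = k
    · rw [← twistedDiff_diag hA hM (degreeLT_mono (by omega) hDM) hb]
      exact hDM b b (by omega)
    · exact (hA.map (frobenius R 2)).act_mem_homogeneous hsupp b hb
  · rintro M ⟨hM, hDM⟩ ⟨u, hu, hMu⟩
    set M₁ := M - twistedDiff A (tateLift A u) with hM₁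
    have hD₁ : twistedDiff A M₁ = twistedDiff A M := by
      rw [hM₁, map_sub, twistedDiff_twistedDiff hA, sub_zero]
    have h₁ : M₁ ∈ degreeLT R deg (2 * k + 2 + 1) := by
      refine Submodule.sub_mem _ hM ?_
      rw [twistedDiff_tateLift hA]
      intro a b hab
      rw [conj_diagonal_apply]
      refine Finset.sum_eq_zero fun c _ => ?_
      by_cases hac : A a c = 0
      · simp [hac]
      by_cases hbc : A b c = 0
      · simp [hbc]
      rw [hu c (by have := hA.deg_eq _ _ hac; have := hA.deg_eq _ _ hbc; omega)]
      simp
    obtain ⟨X, hX⟩ := exists_sub_twistedDiff_mem hidx hA h₁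
      (hD₁ ▸ degreeLT_mono (by omega) hDM) fun b hb => by
        rw [hM₁, Matrix.sub_apply, twistedDiff_tateLift hA, conj_diagonal_diag, hMu,
          diagPart_apply, if_pos (by omega), sub_self]
    have hD₂ : twistedDiff A (M₁ - twistedDiff A X) = twistedDiff A M := by
      rw [map_sub, twistedDiff_twistedDiff hA, sub_zero, hD₁]
    obtain ⟨X', hX'⟩ := exists_sub_twistedDiff_mem (n := 2 * k + 1) hidx hA hX
      (hD₂ ▸ degreeLT_mono (by omega) hDM) fun b hb => by omega
    have hD₃ : twistedDiff A (M₁ - twistedDiff A X - twistedDiff A X') = twistedDiff A M := by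
      rw [map_sub, twistedDiff_twistedDiff hA, sub_zero, hD₂]
    exact ⟨_, ⟨hX', show _ ∈ degreeLT R deg m from hD₃ ▸ hDM⟩, hD₃⟩

end TensorSquare

section TateComparison

variable {R I : Type*} [CommRing R] [Fintype I] [DecidableEq I] [CharP R 2]
  {deg : I → ℕ} {A : Matrix I I R}

/-- Twisted cycles of degree less than `n`, together with all twisted boundaries. -/
def lowCycles (deg : I → ℕ) (A : Matrix I I R) (n : ℕ) : Submodule R (Matrix I I R) :=
  (LinearMap.ker (twistedDiff A) ⊓ degreeLT R deg n) ⊔ LinearMap.range (twistedDiff A)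

omit [CharP R 2] in
theorem conj_diagonal_mem (hA : IsGradedDiff deg A) {j : ℕ} {v : I → R}
    (hv : v ∈ homogeneous R deg R j) :
    A * Matrix.diagonal v * A.transpose ∈ degreeLT R deg (2 * j - 1) := by
  intro a b hab
  rw [conj_diagonal_apply]
  refine Finset.sum_eq_zero fun c _ => ?_
  by_cases hac : A a c = 0
  · simp [hac]
  by_cases hbc : A b c = 0
  · simp [hbc]
  rw [hv c (by have := hA.deg_eq _ _ hac; have := hA.deg_eq _ _ hbc; omega)]
  simp

omit [CharP R 2] in
theorem tateLift_mem (hA : IsGradedDiff deg A) {j : ℕ} {v : I → R}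
    (hv : v ∈ homogeneous R deg R j) : tateLift A v ∈ degreeLT R deg (2 * j + 1) := by
  intro a b hab
  change Matrix.diagonal v a b + (Matrix.diagonal v * A.transpose) a b = 0
  rw [Matrix.diagonal_mul, Matrix.transpose_apply]
  by_cases ha : deg a = j
  · have hba : A b a = 0 := by
      by_contra h
      have := hA.deg_eq _ _ h
      omega
    have hne : a ≠ b := by rintro rfl; omega
    simp [hba, hne]
  · by_cases h : a = b
    · subst h; simp [hv a ha]
    · simp [hv a ha, h]

theorem homologyLength_frobenius_le (hA : IsGradedDiff deg A) {n j : ℕ} (hn : ∀ a, deg a ≤ n)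
    (hj : j ≤ 1) :
    homologyLength deg (A.map (frobenius R 2)) R j ≤
      ∑ w ∈ Finset.range n, homologyLength deg (A.map (frobenius R 2)) R (j + 2 + w) +
        relLength (lowCycles deg A (2 * j + 1)) (lowCycles deg A (2 * j - 1)) := by
  obtain ⟨idx, hidx⟩ : ∃ idx : I → ℕ, Function.Injective idx :=
    ⟨fun a => Fintype.equivFin I a, fun a b h => (Fintype.equivFin I).injective (Fin.ext h)⟩
  let f : (I → R) →ₗ[R] Matrix I I R :=
    tateLift A + upperPart R idx ∘ₗ twistedDiff A ∘ₗ tateLift A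
  have hf (v : I → R) : f v = tateLift A v + upperPart R idx (twistedDiff A (tateLift A v)) := rfl
  have hup {v : I → R} (hv : v ∈ homogeneous R deg R j) :
      upperPart R idx (twistedDiff A (tateLift A v)) ∈ degreeLT R deg (2 * j - 1) := by
    intro a b hab
    rw [upperPart_apply, twistedDiff_tateLift hA, conj_diagonal_mem hA hv a b hab, ite_self]
  have hfT {v : I → R} (hv : v ∈ homogeneous R deg R j) : f v ∈ degreeLT R deg (2 * j + 1) :=
    Submodule.add_mem _ (tateLift_mem hA hv) (degreeLT_mono (by omega) (hup hv))
  have hfD {v : I → R} (hv : v ∈ gradedCycles deg (A.map (frobenius R 2)) R j) :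
      twistedDiff A (f v) = 0 := by
    have h0 : upperPart R idx (twistedDiff A (tateLift A v)) ∈ degreeLT R deg (0 + 1) :=
      degreeLT_mono (by omega) (hup hv.1)
    have hs (a b : I) : (A * Matrix.diagonal v * A.transpose) a b =
        (A * Matrix.diagonal v * A.transpose) b a := by
      rw [conj_diagonal_apply, conj_diagonal_apply]
      exact Finset.sum_congr rfl fun c _ => by ring
    ext a b
    rw [hf, map_add, Matrix.add_apply, hA.twistedDiff_apply_of_mem h0 (Nat.zero_le _),
      upperPart_apply, upperPart_apply, twistedDiff_tateLift hA]
    rcases lt_trichotomy (idx a) (idx b) with h | h | h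
    · simp [h, h.not_gt, CharTwo.add_self_eq_zero]
    · obtain rfl := hidx h
      rw [conj_diagonal_diag, show (A.map (frobenius R 2)).act R v = 0 from hv.2]
      simp
    · simp [h, h.not_gt, hs a b, CharTwo.add_self_eq_zero]
  have hfd {v : I → R} (hv : v ∈ homogeneous R deg R j) : diagPart R deg j (f v) = v := by
    ext b
    rw [diagPart_apply]
    split_ifs with hb
    · have hbb : A b b = 0 := by
        by_contra h
        have := hA.deg_eq _ _ h
        omega
      rw [hf, Matrix.add_apply, upperPart_apply, if_neg (lt_irrefl _), add_zero]
      change Matrix.diagonal v b b + (Matrix.diagonal v * A.transpose) b b = v b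
      rw [Matrix.diagonal_mul, Matrix.transpose_apply, hbb, Matrix.diagonal_apply_eq]
      simp
    · exact (hv b hb).symm
  refine (relLength_le_add _ _ ((lowCycles deg A (2 * j - 1)).comap f)).trans
    (add_le_add ?_ (relLength_le_of_inj f ?_ fun x _ h => h))
  · refine le_trans ?_ (relLength_le_sum (fun w => boundedBoundaries deg A (2 * j + 1) (j + 1 + w)) _
      (fun w => ?_) n)
    · refine relLength_le_of_surj (diagPart R deg j) ?_ ?_
      · rintro v ⟨hv, hfv⟩
        obtain ⟨w, hw, _, ⟨M, rfl⟩, hM⟩ := Submodule.mem_sup.1 hfv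
        refine ⟨twistedDiff A M, ⟨M, ⟨?_, ?_⟩, rfl⟩, ?_⟩
        · intro a b hab
          have := hn a
          have := hn b
          omega
        · change twistedDiff A M ∈ degreeLT R deg (2 * j + 1)
          rw [← sub_eq_iff_eq_add'.2 hM.symm]
          exact Submodule.sub_mem _ (hfT hv.1) (degreeLT_mono (by omega) hw.2)
        · have hw0 : diagPart R deg j w = 0 := by
            ext b
            rw [diagPart_apply]
            split_ifs with hb
            · refine hw.2 b b (by omega)
            · rfl
          have : diagPart R deg j (twistedDiff A M) = v := by
            rw [← sub_eq_iff_eq_add'.2 hM.symm, map_sub, hw0, sub_zero, hfd hv.1]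
          rw [this, sub_self]
          exact Submodule.zero_mem _
      · rintro _ - ⟨M, ⟨hM, hDM⟩, rfl⟩
        refine ⟨diagPart R deg (j + 1) M, fun a ha => by simp [diagPart_apply, ha], ?_⟩
        ext b
        rw [diagPart_apply]
        split_ifs with hb
        · exact (twistedDiff_diag hA hM hDM hb).symm
        · exact (hA.map (frobenius R 2)).act_mem_homogeneous
            (fun a ha => by simp [diagPart_apply, ha]) b hb
    · have := relLength_boundedBoundaries_le (k := j + 1 + w) (m := 2 * j + 1) hA (by omega)
      rwa [show j + 2 + w = j + 1 + w + 1 by omega]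
  · intro v hv
    exact Submodule.mem_sup_left ⟨hfD hv, hfT hv.1⟩

/-- The homology of the Frobenius pullback in degrees `0` and `1` is bounded by the homology of the
twisted tensor square, up to the homology of the Frobenius pullback in higher degrees. -/
theorem homologyLength_zero_add_one_le (hA : IsGradedDiff deg A) {n : ℕ} (hn : ∀ a, deg a ≤ n) :
    homologyLength deg (A.map (frobenius R 2)) R 0 +
      homologyLength deg (A.map (frobenius R 2)) R 1 ≤
      ∑ w ∈ Finset.range n, homologyLength deg (A.map (frobenius R 2)) R (2 + w) +
      ∑ w ∈ Finset.range n, homologyLength deg (A.map (frobenius R 2)) R (3 + w) +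
      relLength (LinearMap.ker (twistedDiff A)) (LinearMap.range (twistedDiff A)) := by
  have h0 := homologyLength_frobenius_le hA hn (j := 0) (by omega)
  have h1 := homologyLength_frobenius_le hA hn (j := 1) (by omega)
  simp only [Nat.zero_add, Nat.mul_zero, Nat.mul_one, Nat.reduceAdd, Nat.reduceSub,
    Nat.zero_sub] at h0 h1
  have hr (n : ℕ) : LinearMap.range (twistedDiff A) ≤ lowCycles deg A n := le_sup_right
  have hm : lowCycles deg A 1 ≤ lowCycles deg A 3 :=
    sup_le_sup_right (inf_le_inf_left _ (degreeLT_mono (by omega))) _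
  have h3 : lowCycles deg A 3 ≤ LinearMap.ker (twistedDiff A) := by
    refine sup_le inf_le_left ?_
    rintro _ ⟨M, rfl⟩
    exact twistedDiff_twistedDiff hA M
  have hc : relLength (lowCycles deg A 1) (lowCycles deg A 0) +
      relLength (lowCycles deg A 3) (lowCycles deg A 1) ≤
      relLength (LinearMap.ker (twistedDiff A)) (LinearMap.range (twistedDiff A)) := by
    calc _ ≤ relLength (lowCycles deg A 1) (LinearMap.range (twistedDiff A)) +
          relLength (lowCycles deg A 3) (lowCycles deg A 1) := by
          gcongr
          exact relLength_mono le_rfl (hr 0)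
      _ = relLength (lowCycles deg A 3) (LinearMap.range (twistedDiff A)) :=
          (relLength_add (hr 1) hm).symm
      _ ≤ _ := relLength_mono h3 le_rfl
  refine (add_le_add h0 h1).trans ?_
  rw [add_add_add_comm]
  gcongr

/-- The homology of the twisted tensor square is bounded by that of the untwisted one. -/
theorem relLength_twistedDiff_le (hA : IsGradedDiff deg A) {n : ℕ} (hn : ∀ a, deg a ≤ n) :
    relLength (LinearMap.ker (twistedDiff A)) (LinearMap.range (twistedDiff A)) ≤
      Fintype.card I * ∑ q ∈ Finset.range (n + 1), homologyLength deg A R q := by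
  classical
  set N := Fintype.card I with hN
  set K := (n + 1) * N with hK
  let idx : I → ℕ := fun a => deg a * N + Fintype.equivFin I a
  have hidxK (a : I) : idx a < K := by
    have h1 := (Fintype.equivFin I a).2
    have h2 : (deg a + 1) * N ≤ (n + 1) * N := Nat.mul_le_mul_right _ (by have := hn a; omega)
    simp only [idx, hK]
    linarith [h1, h2, add_mul (deg a) 1 N]
  have hidxdeg {a b : I} (h : deg a < deg b) : idx a < idx b := by
    have h1 := (Fintype.equivFin I a).2
    have h2 : (deg a + 1) * N ≤ deg b * N := Nat.mul_le_mul_right _ h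
    simp only [idx]
    linarith [h1, h2, add_mul (deg a) 1 N]
  have hidx : Function.Injective idx := by
    intro a b h
    rcases lt_trichotomy (deg a) (deg b) with h' | h' | h'
    · exact absurd h (hidxdeg h').ne
    · simp only [idx, h'] at h
      exact (Fintype.equivFin I).injective (Fin.ext (by omega))
    · exact absurd h (hidxdeg h').ne'
  let key : I → ℕ → ℕ := fun a q => K * (deg a + q) + (K - 1 - idx a)
  have hkey_deg {a b : I} {p q : ℕ} (h : deg a + p < deg b + q) : key a p < key b q := by
    have h1 := hidxK a
    have h2 : K * (deg a + p + 1) ≤ K * (deg b + q) := Nat.mul_le_mul_left _ h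
    have h3 : K * (deg a + p + 1) = K * (deg a + p) + K := by ring
    simp only [key]
    omega
  have hkey_idx {a b : I} {p q : ℕ} (h : deg a + p = deg b + q) (h' : idx b < idx a) :
      key a p < key b q := by
    have h1 := hidxK a
    simp only [key, h]
    omega
  have hkey_inj {a b : I} {p q : ℕ} (h : key a p = key b q) : a = b ∧ p = q := by
    have hd : deg a + p = deg b + q := by
      rcases lt_trichotomy (deg a + p) (deg b + q) with h' | h' | h'
      · exact absurd h (hkey_deg h').ne
      · exact h'
      · exact absurd h (hkey_deg h').ne'
    have hab : a = b := by
      apply hidx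
      rcases lt_trichotomy (idx a) (idx b) with h' | h' | h'
      · exact absurd h (hkey_idx hd.symm h').ne'
      · exact h'
      · exact absurd h (hkey_idx hd h').ne
    subst hab
    exact ⟨rfl, by omega⟩
  let G : ℕ → Submodule R (Matrix I I R) := fun w =>
    { carrier := {M | ∀ a b, key a (deg b) < w → M a b = 0}
      add_mem' := fun hv hw a b ha => by simp [hv a b ha, hw a b ha]
      zero_mem' := fun _ _ _ => rfl
      smul_mem' := fun r v hv a b ha => by simp [hv a b ha] }
  let X : ℕ → Submodule R (Matrix I I R) := fun w =>
    (LinearMap.ker (twistedDiff A) ⊓ G w) ⊔ LinearMap.range (twistedDiff A)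
  have hstep (a : I) (q : ℕ) :
      relLength (X (key a q)) (X (key a q + 1)) ≤ homologyLength deg A R q := by
    refine (relLength_le_of_surj (A' := LinearMap.ker (twistedDiff A) ⊓ G (key a q))
      (B' := X (key a q + 1)) LinearMap.id ?_ fun _ _ h => h).trans (relLength_le_of_inj
        { toFun := fun M b => if deg b = q then M a b else 0
          map_add' := fun M N => by ext b; by_cases h : deg b = q <;> simp [h]
          map_smul' := fun r M => by ext b; by_cases h : deg b = q <;> simp [h] } ?_ ?_)
    · intro x hx
      obtain ⟨y, hy, z, hz, rfl⟩ := Submodule.mem_sup.1 hx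
      exact ⟨y, hy, Submodule.mem_sup_right (by simpa using hz)⟩
    · rintro M ⟨hM, hG⟩
      have hs : (fun b => if deg b = q then M a b else 0) ∈ homogeneous R deg R q :=
        fun b hb => if_neg hb
      refine ⟨hs, ?_⟩
      ext b
      by_cases hb : deg b + 1 = q
      · have h := twistedDiff_apply A M a b
        rw [show twistedDiff A M = 0 from hM, hG a b (hkey_deg (by omega)),
          hG b a (hkey_deg (by omega)), Finset.sum_eq_zero, zero_add, add_zero, add_zero] at h
        · change (A.act R fun b => if deg b = q then M a b else 0) b = 0
          rw [Matrix.act_apply, ← Matrix.zero_apply (α := R) a b, h]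
          refine Finset.sum_congr rfl fun c _ => ?_
          by_cases hc : A b c = 0
          · simp [hc]
          · rw [if_pos (by rw [hA.deg_eq _ _ hc, hb]), smul_eq_mul, mul_comm]
        · intro c _
          by_cases hc : A a c = 0
          · simp [hc]
          · have hdc := hA.deg_eq _ _ hc
            rw [hG c b (hkey_idx (by omega) (hidxdeg (by omega))), mul_zero]
      · change (A.act R fun b => if deg b = q then M a b else 0) b = 0
        rw [Matrix.act_apply]
        refine Finset.sum_eq_zero fun c _ => ?_
        by_cases hc : A b c = 0
        · simp [hc]
        · rw [if_neg (by rw [hA.deg_eq _ _ hc]; exact hb), smul_zero]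
    · rintro M ⟨hM, hG⟩ ⟨u, hu, hMu⟩
      replace hMu (b : I) : A.act R u b = if deg b = q then M a b else 0 := congrFun hMu b
      let U : Matrix I I R := Matrix.of fun c b => if c = a then u b else 0
      have hU (c b : I) : U c b = if c = a then u b else 0 := rfl
      rw [← sub_add_cancel M (twistedDiff A U)]
      refine Submodule.mem_sup.2 ⟨_, ⟨?_, ?_⟩, _, ⟨U, rfl⟩, rfl⟩
      · change twistedDiff A (M - twistedDiff A U) = 0
        rw [map_sub, twistedDiff_twistedDiff hA, sub_zero]
        exact hM
      · intro c b hcb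
        have hu' : deg b ≠ q + 1 → u b = 0 := hu b
        have hlt : key a q < key a (q + 1) := hkey_deg (by omega)
        have h1 : U c b = 0 := by
          rw [hU]
          split_ifs with h
          · subst h
            exact hu b fun h' => by rw [h'] at hcb; omega
          · rfl
        have h2 : U b c = 0 := by
          rw [hU]
          split_ifs with h
          · subst h
            refine hu c fun h' => ?_
            have : key b q < key c (deg b) := hkey_deg (by omega)
            omega
          · rfl
        have h3 : ∑ e, A c e * U e b = 0 := by
          refine Finset.sum_eq_zero fun e _ => ?_
          by_cases he : A c e = 0
          · simp [he]
          rw [hU]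
          split_ifs with h
          · subst h
            have hde := hA.deg_eq _ _ he
            rw [hu b fun h' => ?_, mul_zero]
            have : key e q < key c (deg b) := hkey_idx (by omega) (hidxdeg (by omega))
            omega
          · rw [mul_zero]
        have h4 : ∑ e, U c e * A b e = if c = a then A.act R u b else 0 := by
          split_ifs with h
          · rw [Matrix.act_apply]
            exact Finset.sum_congr rfl fun e _ => by rw [hU, if_pos h, smul_eq_mul, mul_comm]
          · exact Finset.sum_eq_zero fun e _ => by rw [hU, if_neg h, zero_mul]
        rw [Matrix.sub_apply, twistedDiff_apply, h1, h2, h3, h4, zero_add, add_zero, add_zero]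
        rcases (Nat.lt_succ_iff.1 hcb).lt_or_eq with hlt | heq
        · rw [hG c b hlt, zero_sub, neg_eq_zero]
          split_ifs with h
          · subst h
            rw [hMu]
            split_ifs with hb
            · rw [hb] at hlt; exact absurd hlt (lt_irrefl _)
            · rfl
          · rfl
        · obtain ⟨rfl, hb⟩ := hkey_inj heq
          rw [if_pos rfl, hMu, if_pos hb, sub_self]
  have hstep' (w : ℕ) : relLength (X w) (X (w + 1)) ≤
      ∑ p ∈ (Finset.univ ×ˢ Finset.range (n + 1)).filter (fun p : I × ℕ => key p.1 p.2 = w),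
        homologyLength deg A R p.2 := by
    by_cases h : ∃ p : I × ℕ, p.2 < n + 1 ∧ key p.1 p.2 = w
    · obtain ⟨p, hp, rfl⟩ := h
      exact (hstep p.1 p.2).trans (Finset.single_le_sum_of_canonicallyOrdered
        (f := fun p : I × ℕ => homologyLength deg A R p.2) (by simp [hp]))
    · rw [relLength_eq_zero]
      · exact zero_le
      · refine sup_le_sup_right (inf_le_inf_left _ fun M hM a b hab => ?_) _
        rcases (Nat.lt_succ_iff.1 hab).lt_or_eq with hlt | heq
        · exact hM a b hlt
        · exact absurd ⟨(a, deg b), Nat.lt_succ_of_le (hn b), heq⟩ h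
  set W := K * (2 * n + 1) with hW
  have htop (a : I) (q : ℕ) (hq : q < n + 1) : key a q < W := by
    have h1 := hidxK a
    have h2 : K * (deg a + q + 1) ≤ K * (2 * n + 1) :=
      Nat.mul_le_mul_left _ (by have := hn a; omega)
    have h3 : K * (deg a + q + 1) = K * (deg a + q) + K := by ring
    simp only [key, hW]
    omega
  have hX0 : LinearMap.ker (twistedDiff A) ≤ X 0 := fun M hM =>
    Submodule.mem_sup_left ⟨hM, fun a b h => absurd h (Nat.not_lt_zero _)⟩
  have hXW : X W ≤ LinearMap.range (twistedDiff A) := by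
    refine sup_le (fun M hM => ?_) le_rfl
    have : M = 0 := by
      ext a b
      exact hM.2 a b (htop a _ (Nat.lt_succ_of_le (hn b)))
    exact this ▸ Submodule.zero_mem _
  have hsum (m : ℕ) : relLength (X 0) (X m) ≤ ∑ w ∈ Finset.range m,
      ∑ p ∈ (Finset.univ ×ˢ Finset.range (n + 1)).filter (fun p : I × ℕ => key p.1 p.2 = w),
        homologyLength deg A R p.2 := by
    induction m with
    | zero => simp [relLength_eq_zero]
    | succ m ih =>
      rw [Finset.sum_range_succ]
      refine (relLength_le_add _ _ (X m)).trans ((add_comm _ _).trans_le (add_le_add ?_ ?_))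
      · exact ih
      · exact (relLength_mono inf_le_right le_rfl).trans (hstep' m)
  calc _ ≤ relLength (X 0) (X W) := relLength_mono hX0 hXW
    _ ≤ _ := hsum W
    _ = ∑ p ∈ Finset.univ ×ˢ Finset.range (n + 1), homologyLength deg A R (p : I × ℕ).2 := by
        refine Finset.sum_fiberwise_of_maps_to (fun p hp => ?_) _
        simp only [Finset.mem_product, Finset.mem_range] at hp
        exact Finset.mem_range.2 (htop _ _ hp.2)
    _ = _ := by
        rw [Finset.sum_product]
        simp [hN]

end TateComparison

section Homotopy

variable {R I : Type*} [CommRing R] [Fintype I] {deg : I → ℕ} {A : Matrix I I R}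

theorem Matrix.act_smul_one [DecidableEq I] {M : Type*} [AddCommGroup M] [Module R M] (z : R)
    (v : I → M) : (z • (1 : Matrix I I R)).act M v = z • v := by
  ext a
  simp [Matrix.act_apply, Matrix.one_apply]

theorem Matrix.act_compLeft {M M' : Type*} [AddCommGroup M] [Module R M] [AddCommGroup M']
    [Module R M'] (A : Matrix I I R) (f : M →ₗ[R] M') (v : I → M) :
    A.act M' (f.compLeft I v) = f.compLeft I (A.act M v) := by
  ext a
  simp [Matrix.act_apply]

/-- If `x` annihilates the homology in degrees less than `k`, then multiplication by `x ^ k` is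
null-homotopic in these degrees. -/
theorem IsGradedDiff.exists_homotopy [DecidableEq I] (hA : IsGradedDiff deg A) (x : R) (k : ℕ)
    (h : ∀ j < k, ∀ v ∈ gradedCycles deg A R j, x • v ∈ gradedBoundaries deg A R j) :
    ∃ s : Matrix I I R, (∀ a b, s a b ≠ 0 → deg a = deg b + 1) ∧
      ∀ b, deg b < k → ∀ a, (A * s + s * A) a b = if a = b then x ^ k else 0 := by
  induction k with
  | zero => exact ⟨0, by simp, fun b hb => absurd hb (Nat.not_lt_zero _)⟩
  | succ k ih =>
    obtain ⟨s, hs, hAs⟩ := ih fun j hj => h j (hj.trans k.lt_succ_self)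
    have key (b : I) (hb : deg b = k) : ∃ t ∈ homogeneous R deg R (k + 1), ∀ a,
        A.act R t a = x * ((if a = b then x ^ k else 0) - (s * A) a b) := by
      suffices hc : (fun a => (if a = b then x ^ k else 0) - (s * A) a b) ∈
          gradedCycles deg A R k by
        obtain ⟨t, ht, hAt⟩ := h k k.lt_succ_self _ hc
        exact ⟨t, ht, fun a => by rw [hAt]; rfl⟩
      refine ⟨fun a ha => ?_, ?_⟩
      · have hab : a ≠ b := by rintro rfl; exact ha hb
        change (if a = b then x ^ k else 0) - (s * A) a b = 0
        rw [if_neg hab, zero_sub, neg_eq_zero, Matrix.mul_apply]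
        refine Finset.sum_eq_zero fun c _ => ?_
        by_cases hac : s a c = 0
        · simp [hac]
        by_cases hcb : A c b = 0
        · simp [hcb]
        have := hs _ _ hac
        have := hA.deg_eq _ _ hcb
        omega
      · ext a
        have h1 : (A * s * A) a b = x ^ k * A a b - (s * A * A) a b := by
          rw [eq_sub_iff_add_eq, ← Matrix.add_apply, ← add_mul, Matrix.mul_apply,
            Finset.sum_eq_single a]
          · by_cases hab : A a b = 0
            · simp [hab]
            · rw [hAs a (by have := hA.deg_eq _ _ hab; omega), if_pos rfl]
          · intro c _ hca
            by_cases hcb : A c b = 0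
            · simp [hcb]
            · rw [hAs c (by have := hA.deg_eq _ _ hcb; omega), if_neg hca.symm, zero_mul]
          · simp
        have h2 : A.act R (fun a => (if a = b then x ^ k else 0) - (s * A) a b) a =
            x ^ k * A a b - (A * s * A) a b := by
          rw [Matrix.mul_assoc, Matrix.mul_apply (M := A), Matrix.act_apply]
          simp [mul_sub, mul_comm (A a b)]
        rw [h2, h1, Matrix.mul_assoc, hA.sq]
        simp
    choose t ht hAt using key
    let s' : Matrix I I R := Matrix.of fun a b =>
      if hb : deg b = k then t b hb a else x * s a b
    have hs'k (a b : I) (hb : deg b = k) : s' a b = t b hb a := dif_pos hb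
    have hs' (a b : I) (hb : deg b ≠ k) : s' a b = x * s a b := dif_neg hb
    refine ⟨s', fun a b hab => ?_, fun b hb a => ?_⟩
    · by_cases hb : deg b = k
      · rw [hs'k a b hb] at hab
        by_contra h'
        exact hab (ht b hb a (by omega))
      · rw [hs' a b hb] at hab
        exact hs a b fun h' => hab (by rw [h', mul_zero])
    · have h1 : (s' * A) a b = x * (s * A) a b := by
        rw [Matrix.mul_apply, Matrix.mul_apply, Finset.mul_sum]
        refine Finset.sum_congr rfl fun c _ => ?_
        by_cases hcb : A c b = 0
        · simp [hcb]
        · rw [hs' a c (by have := hA.deg_eq _ _ hcb; omega), mul_assoc]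
      rw [Matrix.add_apply, h1]
      by_cases hbk : deg b = k
      · have h2 : (A * s') a b = A.act R (t b hbk) a := by
          rw [Matrix.mul_apply, Matrix.act_apply]
          exact Finset.sum_congr rfl fun c _ => by rw [hs'k c b hbk, smul_eq_mul]
        rw [h2, hAt]
        split_ifs <;> ring
      · have h2 : (A * s') a b = x * (A * s) a b := by
          rw [Matrix.mul_apply, Matrix.mul_apply, Finset.mul_sum]
          refine Finset.sum_congr rfl fun c _ => ?_
          rw [hs' c b hbk]
          ring
        rw [h2, ← mul_add, ← Matrix.add_apply, hAs b (by omega)]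
        split_ifs <;> ring

end Homotopy

section Coefficients

variable {R I : Type*} [CommRing R] [Fintype I] {deg : I → ℕ} {A : Matrix I I R}
  {M M₁ M₂ M₃ : Type*} [AddCommGroup M] [Module R M] [AddCommGroup M₁] [Module R M₁]
  [AddCommGroup M₂] [Module R M₂] [AddCommGroup M₃] [Module R M₃]

theorem homologyLength_le_length (k : ℕ) :
    homologyLength deg A M k ≤ Fintype.card I * Module.length R M := by
  refine (relLength_le_length _ _).trans ?_
  rw [Module.length_pi, ENat.card_eq_coe_fintype_card]

omit [Fintype I] in
theorem compLeft_mem_homogeneous (f : M₁ →ₗ[R] M₂) {k : ℕ} {v : I → M₁}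
    (hv : v ∈ homogeneous R deg M₁ k) : f.compLeft I v ∈ homogeneous R deg M₂ k :=
  fun a ha => by simp [hv a ha]

omit [Fintype I] in
theorem exists_compLeft_eq_of_mem_homogeneous (g : M₁ →ₗ[R] M₂) (hg : Function.Surjective g) {k : ℕ}
    {v : I → M₂} (hv : v ∈ homogeneous R deg M₂ k) :
    ∃ u ∈ homogeneous R deg M₁ k, g.compLeft I u = v := by
  choose r hr using hg
  refine ⟨fun a => if deg a = k then r (v a) else 0, fun a ha => if_neg ha, funext fun a => ?_⟩
  by_cases ha : deg a = k
  · simp [ha, hr]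
  · simp [ha, hv a ha]

theorem homologyLength_le_add_of_exact (hA : IsGradedDiff deg A) (f : M₁ →ₗ[R] M₂) (g : M₂ →ₗ[R] M₃)
    (hf : Function.Injective f) (hg : Function.Surjective g) (hfg : Function.Exact f g) (k : ℕ) :
    homologyLength deg A M₂ k ≤ homologyLength deg A M₁ k + homologyLength deg A M₃ k := by
  refine (relLength_le_add _ _ ((gradedBoundaries deg A M₃ k).comap (g.compLeft I))).trans
    (add_le_add ?_ (relLength_le_of_inj (g.compLeft I) ?_ fun _ _ h => h))
  · refine relLength_le_of_surj (f.compLeft I) ?_ ?_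
    · rintro x ⟨⟨hx, hAx⟩, u, hu, hux⟩
      obtain ⟨u', hu', rfl⟩ := exists_compLeft_eq_of_mem_homogeneous g hg hu
      rw [Matrix.act_compLeft] at hux
      have hker (a : I) : g ((x - A.act M₂ u') a) = 0 := by
        have := congrFun hux a
        simp only [LinearMap.compLeft_apply, Function.comp_apply] at this
        rw [Pi.sub_apply, map_sub, this, sub_self]
      choose y hy using fun a => (hfg _).1 (hker a)
      have hy' : f.compLeft I y = x - A.act M₂ u' := funext hy
      refine ⟨y, ⟨fun a ha => hf ?_, ?_⟩, ?_⟩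
      · rw [hy, map_zero, Pi.sub_apply, hx a ha, hA.act_mem_homogeneous hu' a ha, sub_zero]
      · refine hf.comp_left (?_ : f.compLeft I (A.act M₁ y) = f.compLeft I 0)
        rw [← Matrix.act_compLeft, hy', map_sub, show A.act M₂ x = 0 from hAx, hA.act_act]
        simp
      · rw [hy', sub_sub_cancel_left]
        exact Submodule.neg_mem _ ⟨u', hu', rfl⟩
    · rintro _ - ⟨u, hu, rfl⟩
      exact ⟨f.compLeft I u, compLeft_mem_homogeneous f hu, Matrix.act_compLeft _ _ _⟩
  · rintro v ⟨hv, hAv⟩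
    refine ⟨compLeft_mem_homogeneous g hv, ?_⟩
    change A.act M₃ (g.compLeft I v) = 0
    rw [Matrix.act_compLeft, show A.act M₂ v = 0 from hAv, map_zero]

theorem homologyLength_le_of_equiv (f : M₁ ≃ₗ[R] M₂) (k : ℕ) :
    homologyLength deg A M₁ k ≤ homologyLength deg A M₂ k := by
  refine relLength_le_of_inj (f.toLinearMap.compLeft I) ?_ ?_
  · rintro v ⟨hv, hAv⟩
    refine ⟨compLeft_mem_homogeneous _ hv, ?_⟩
    change A.act M₂ (f.toLinearMap.compLeft I v) = 0
    rw [Matrix.act_compLeft, show A.act M₁ v = 0 from hAv, map_zero]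
  · rintro v - ⟨u, hu, huv⟩
    refine ⟨f.symm.toLinearMap.compLeft I u, compLeft_mem_homogeneous _ hu, ?_⟩
    rw [Matrix.act_compLeft, huv]
    ext a
    simp

theorem homologyLength_of_subsingleton [Subsingleton M] (k : ℕ) : homologyLength deg A M k = 0 :=
  relLength_eq_zero fun x _ => Subsingleton.elim (0 : I → M) x ▸ Submodule.zero_mem _

/-- The quotient of a module by the multiples of a ring element. -/
abbrev ModSMul (z : R) (M : Type*) [AddCommGroup M] [Module R M] : Type _ :=
  M ⧸ LinearMap.range (LinearMap.lsmul R M z)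

/-- Multiplication by `z` being null-homotopic, the homology with coefficients in `M` embeds in
the homology with coefficients in `M / z M`. -/
theorem homologyLength_le_modSMul [DecidableEq I] (hA : IsGradedDiff deg A) {s : Matrix I I R}
    {z : R} (hs : ∀ a b, s a b ≠ 0 → deg a = deg b + 1) (hAs : A * s + s * A = z • 1)
    (hz : ∀ m : M, z • m = 0 → m = 0) (k : ℕ) :
    homologyLength deg A M k ≤ homologyLength deg A (ModSMul z M) (k + 1) := by
  have hz' {v : I → M} (h : z • v = 0) : v = 0 := funext fun a => hz _ (congrFun h a)
  have hact (v : I → M) : A.act M (s.act M v) + s.act M (A.act M v) = z • v := by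
    rw [← Matrix.act_mul_apply, ← Matrix.act_mul_apply, ← Matrix.act_add_apply, hAs,
      Matrix.act_smul_one]
  have hshom {v : I → M} (hv : v ∈ homogeneous R deg M k) :
      s.act M v ∈ homogeneous R deg M (k + 1) := by
    intro a ha
    rw [Matrix.act_apply]
    refine Finset.sum_eq_zero fun b _ => ?_
    by_cases h : s a b = 0
    · simp [h]
    · rw [hv b (by have := hs a b h; omega), smul_zero]
  set π := (LinearMap.range (LinearMap.lsmul R M z)).mkQ with hπ
  have hπ0 (m : M) : π m = 0 ↔ ∃ m', z • m' = m := by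
    rw [hπ, Submodule.mkQ_apply, Submodule.Quotient.mk_eq_zero]
    rfl
  refine relLength_le_of_inj (π.compLeft I ∘ₗ s.act M) ?_ ?_
  · rintro v ⟨hv, hAv⟩
    refine ⟨compLeft_mem_homogeneous π (hshom hv), ?_⟩
    change A.act (ModSMul z M) (π.compLeft I (s.act M v)) = 0
    have h := hact v
    rw [show A.act M v = 0 from hAv, map_zero, add_zero] at h
    rw [Matrix.act_compLeft, h]
    exact funext fun a => (hπ0 _).2 ⟨v a, rfl⟩
  · rintro v ⟨hv, hAv⟩ ⟨u', hu', huv⟩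
    obtain ⟨u, hu, rfl⟩ := exists_compLeft_eq_of_mem_homogeneous π
      (Submodule.mkQ_surjective _) hu'
    rw [Matrix.act_compLeft] at huv
    have hker (a : I) : ∃ m, z • m = (s.act M v - A.act M u) a := by
      rw [← hπ0, Pi.sub_apply, map_sub, sub_eq_zero]
      exact (congrFun huv a).symm
    choose w hw using hker
    have hw' : z • w = s.act M v - A.act M u := funext hw
    refine ⟨w, fun a ha => hz _ ?_, ?_⟩
    · rw [hw, Pi.sub_apply, hshom hv a ha, hA.act_mem_homogeneous hu a ha, sub_zero]
    · rw [← sub_eq_zero]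
      apply hz'
      have h := hact v
      rw [show A.act M v = 0 from hAv, map_zero, add_zero] at h
      rw [smul_sub, ← map_smul, hw', map_sub, hA.act_act, sub_zero, h, sub_self]

theorem homologyLength_modSMul_pow_le (hA : IsGradedDiff deg A) {y : R}
    (hy : ∀ m : M, y • m = 0 → m = 0) (k j : ℕ) :
    homologyLength deg A (ModSMul (y ^ j) M) k ≤ j * homologyLength deg A (ModSMul y M) k := by
  induction j with
  | zero =>
    have : Subsingleton (ModSMul (y ^ 0) M) := by
      rw [Submodule.Quotient.subsingleton_iff, LinearMap.range_eq_top]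
      exact fun m => ⟨m, by simp⟩
    rw [homologyLength_of_subsingleton]
    exact zero_le
  | succ j ih =>
    have hyj (m : M) (h : y ^ j • m = 0) : m = 0 := by
      clear ih
      induction j with
      | zero => simpa using h
      | succ j ihj => exact ihj (hy _ (by rwa [smul_smul, ← pow_succ']))
    let f : ModSMul y M →ₗ[R] ModSMul (y ^ (j + 1)) M :=
      Submodule.mapQ _ _ (LinearMap.lsmul R M (y ^ j)) (by
        rintro _ ⟨m, rfl⟩
        exact ⟨m, by simp [smul_smul, pow_succ, mul_comm]⟩)
    have hle : LinearMap.range (LinearMap.lsmul R M (y ^ (j + 1))) ≤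
        LinearMap.range (LinearMap.lsmul R M (y ^ j)) := by
      rintro _ ⟨m, rfl⟩
      exact ⟨y • m, by simp [smul_smul, pow_succ, mul_comm]⟩
    refine (homologyLength_le_add_of_exact hA f (Submodule.factor hle) ?_
      (Submodule.factor_surjective hle) ?_ k).trans ?_
    · refine Submodule.mapQ_injective_of_eq_comap _ (le_antisymm ?_ ?_)
      · rintro _ ⟨m, rfl⟩
        exact ⟨m, by simp [smul_smul, pow_succ']⟩
      · rintro m ⟨m', hm'⟩
        refine ⟨m', sub_eq_zero.1 (hyj _ ?_)⟩
        simp only [LinearMap.lsmul_apply] at hm' ⊢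
        rw [smul_sub, smul_smul, ← pow_succ, hm', sub_self]
    · intro x
      obtain ⟨x, rfl⟩ := Submodule.mkQ_surjective _ x
      constructor
      · intro h
        obtain ⟨m, rfl⟩ := (Submodule.Quotient.mk_eq_zero _).1 h
        exact ⟨Submodule.Quotient.mk m, rfl⟩
      · rintro ⟨m, hm⟩
        obtain ⟨m, rfl⟩ := Submodule.mkQ_surjective _ m
        rw [← hm]
        exact (Submodule.Quotient.mk_eq_zero _).2 ⟨m, rfl⟩
    · rw [add_comm, Nat.cast_succ, add_mul, one_mul]
      gcongr

end Coefficients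

section Growth

universe u

variable {R : Type u} {I : Type*} [CommRing R] [Fintype I] {deg : I → ℕ} {A : Matrix I I R}

/-- For a complex of length `n` with homology supported at the maximal ideal, the homology of the
iterated Frobenius pullbacks with coefficients in a finite module grows, in degrees at least
`n - t`, at most like the `t`-th power of the exponent. -/
theorem IsGradedDiff.exists_homologyLength_frobenius_le [IsNoetherianRing R] [IsLocalRing R]
    [CharP R 2] (hA : IsGradedDiff deg A) {n : ℕ} (hn : ∀ a, deg a ≤ n)
    (hx : ∀ x ∈ IsLocalRing.maximalIdeal R, ∃ c : ℕ, ∀ k, ∀ v ∈ gradedCycles deg A R k,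
      x ^ c • v ∈ gradedBoundaries deg A R k) (t : ℕ)
    (M : Type u) [AddCommGroup M] [Module R M] [Module.Finite R M] :
    ∃ C : ℕ, ∀ e k : ℕ, n ≤ k + t →
      homologyLength deg (A.map (iterateFrobenius R 2 e)) M k ≤ C * (2 ^ e) ^ t := by
  classical
  have step (t : ℕ) (H : ∀ (N : Type u) [AddCommGroup N] [Module R N] [Module.Finite R N],
      ∃ C : ℕ, ∀ e k : ℕ, n ≤ k + t → 2 ^ e *
        homologyLength deg (A.map (iterateFrobenius R 2 e)) N (k + 1) ≤ C * (2 ^ e) ^ t)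
      (M : Type u) [AddCommGroup M] [Module R M] [hM : Module.Finite R M] :
      ∃ C : ℕ, ∀ e k : ℕ, n ≤ k + t →
        homologyLength deg (A.map (iterateFrobenius R 2 e)) M k ≤ C * (2 ^ e) ^ t := by
    induction hM using IsNoetherianRing.induction_on_isQuotientEquivQuotientPrime R with
    | subsingleton N => exact ⟨0, fun e k _ => by simp [homologyLength_of_subsingleton]⟩
    | quotient N p f =>
      by_cases hp : p.asIdeal = IsLocalRing.maximalIdeal R
      · refine ⟨Fintype.card I, fun e k _ => (homologyLength_le_of_equiv f k).trans
          ((homologyLength_le_length k).trans ?_)⟩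
        have : IsSimpleModule R (R ⧸ p.asIdeal) := by
          rw [isSimpleModule_iff_isCoatom, hp]
          exact (IsLocalRing.maximalIdeal.isMaximal R).out
        rw [Module.length_eq_one]
        gcongr
        exact one_le_pow₀ (one_le_pow₀ one_le_two)
      · obtain ⟨x, hxm, hxp⟩ := SetLike.exists_of_lt
          ((IsLocalRing.le_maximalIdeal p.isPrime.ne_top).lt_of_ne hp)
        obtain ⟨c, hc⟩ := hx x hxm
        obtain ⟨s, hs, hAs⟩ := hA.exists_homotopy (x ^ c) (n + 1) fun j _ => hc j
        set y := (x ^ c) ^ (n + 1) with hy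
        have hyp : y ∉ p.asIdeal := fun h => hxp (p.isPrime.mem_of_pow_mem _
          (p.isPrime.mem_of_pow_mem _ h))
        have hAs' : A * s + s * A = y • 1 := by
          ext a b
          rw [hAs b (Nat.lt_succ_of_le (hn b))]
          simp [Matrix.one_apply]
        have hnzd {z : R} (hz : z ∉ p.asIdeal) (m : R ⧸ p.asIdeal) (h : z • m = 0) : m = 0 := by
          have hz' : Ideal.Quotient.mk p.asIdeal z ≠ 0 := by
            rwa [Ne, Ideal.Quotient.eq_zero_iff_mem]
          have := p.isPrime
          rw [Algebra.smul_def] at h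
          exact (mul_eq_zero.1 h).resolve_left hz'
        obtain ⟨C, hC⟩ := H (ModSMul y (R ⧸ p.asIdeal))
        refine ⟨C, fun e k hk => (homologyLength_le_of_equiv f k).trans (le_trans ?_ (hC e k hk))⟩
        have hyq : y ^ 2 ^ e ∉ p.asIdeal := fun h => hyp (p.isPrime.mem_of_pow_mem _ h)
        refine (homologyLength_le_modSMul (hA.map (iterateFrobenius R 2 e))
          (s := s.map (iterateFrobenius R 2 e)) (fun a b h => hs a b fun h' => h (by simp [h']))
          ?_ (hnzd hyq) k).trans ?_
        · rw [← Matrix.map_mul, ← Matrix.map_mul, ← Matrix.map_add _ (map_add _), hAs']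
          ext a b
          by_cases hab : a = b <;> simp [hab, iterateFrobenius_def]
        · refine (homologyLength_modSMul_pow_le (hA.map (iterateFrobenius R 2 e)) (hnzd hyp)
            (k + 1) (2 ^ e)).trans_eq ?_
          push_cast
          rfl
    | exact N₁ N₂ N₃ f g hf hg hfg h₁ h₃ =>
      obtain ⟨C₁, h₁⟩ := h₁
      obtain ⟨C₃, h₃⟩ := h₃
      refine ⟨C₁ + C₃, fun e k hk => (homologyLength_le_add_of_exact
        (hA.map (iterateFrobenius R 2 e)) f g hf hg hfg k).trans ?_⟩
      rw [Nat.cast_add, add_mul]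
      exact add_le_add (h₁ e k hk) (h₃ e k hk)
  induction t generalizing M with
  | zero =>
    refine step 0 (fun N => ?_) M
    intros
    exact ⟨0, fun e k hk => by rw [homologyLength_eq_zero hn (by omega)]; simp⟩
  | succ t ih =>
    refine step (t + 1) (fun N => ?_) M
    intros
    obtain ⟨C, hC⟩ := ih N
    refine ⟨C, fun e k hk => ?_⟩
    rw [pow_succ', mul_left_comm]
    gcongr
    exact hC e (k + 1) (by omega)

end Growth

section HilbertSamuel

variable {R : Type*} [CommRing R]

theorem relLength_ne_zero {N : Type*} [AddCommGroup N] [Module R N] {A B : Submodule R N}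
    (h : ¬ A ≤ B) : relLength A B ≠ 0 := by
  unfold relLength
  rw [Ne, Module.length_eq_zero_iff, Submodule.Quotient.subsingleton_iff]
  exact fun h' => h (Submodule.comap_subtype_eq_top.1 h')

theorem Nat.add_pow_succ_le (n a d : ℕ) :
    (n + a) ^ (d + 1) ≤ n ^ (d + 1) + (d + 1) * a * (n + a) ^ d := by
  induction d with
  | zero => simp
  | succ d ih =>
    calc (n + a) ^ (d + 1 + 1) = n * (n + a) ^ (d + 1) + a * (n + a) ^ (d + 1) := by ring
      _ ≤ n * (n ^ (d + 1) + (d + 1) * a * (n + a) ^ d) + a * (n + a) ^ (d + 1) := by gcongr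
      _ = n ^ (d + 1 + 1) + (d + 1) * a * (n * (n + a) ^ d) + a * (n + a) ^ (d + 1) := by ring
      _ ≤ n ^ (d + 1 + 1) + (d + 1) * a * ((n + a) * (n + a) ^ d) + a * (n + a) ^ (d + 1) := by
          gcongr
          exact Nat.le_add_right n a
      _ = _ := by ring

/-- A form of the Artin–Rees lemma for powers of an ideal modulo a prime. -/
theorem Ideal.IsPrime.exists_mem_sup_pow_of_mul_mem [IsNoetherianRing R] {p : Ideal R}
    (hp : p.IsPrime) {x : R} (hx : x ∉ p) (I : Ideal R) :
    ∃ c, ∀ n r, x * r ∈ p ⊔ I ^ (n + c) → r ∈ p ⊔ I ^ n := by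
  obtain ⟨c, hc⟩ := Ideal.exists_pow_inf_eq_pow_smul (I.map (Ideal.Quotient.mk p))
    (Ideal.span {Ideal.Quotient.mk p x})
  refine ⟨c, fun n r hr => ?_⟩
  have h1 : Ideal.Quotient.mk p x * Ideal.Quotient.mk p r ∈
      (I.map (Ideal.Quotient.mk p)) ^ (n + c) := by
    rwa [← map_mul, ← Ideal.map_pow, Ideal.mem_quotient_iff_mem_sup, sup_comm]
  have h2 : Ideal.Quotient.mk p x * Ideal.Quotient.mk p r ∈
      (I.map (Ideal.Quotient.mk p)) ^ n * Ideal.span {Ideal.Quotient.mk p x} := by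
    have h := hc (n + c) (Nat.le_add_left _ _)
    rw [Nat.add_sub_cancel] at h
    refine Ideal.mul_mono_right (inf_le_right : _ ⊓ Ideal.span {Ideal.Quotient.mk p x} ≤ _)
      (h.le ⟨?_, ?_⟩)
    · simpa using h1
    · exact Ideal.mem_span_singleton.2 (dvd_mul_right _ _)
  obtain ⟨z, hz, hzx⟩ := Ideal.mem_mul_span_singleton.1 h2
  rw [sup_comm, ← Ideal.mem_quotient_iff_mem_sup, Ideal.map_pow]
  have hx' : Ideal.Quotient.mk p x ≠ 0 := by rwa [Ne, Ideal.Quotient.eq_zero_iff_mem]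
  rw [mul_comm] at hzx
  exact mul_left_cancel₀ hx' hzx ▸ hz

theorem exists_pow_le_mul_relLength_of_chain [IsNoetherianRing R] [IsLocalRing R] (d : ℕ)
    (p : ℕ → PrimeSpectrum R) (hp : ∀ i < d, p i < p (i + 1)) :
    ∃ c : ℕ, ∀ n : ℕ, 1 ≤ n → ((n ^ d : ℕ) : ℕ∞) ≤ c * relLength (⊤ : Submodule R R)
      ((p 0).asIdeal ⊔ IsLocalRing.maximalIdeal R ^ n) := by
  have hpos (q : PrimeSpectrum R) (n : ℕ) (hn : 1 ≤ n) : 1 ≤ relLength (⊤ : Submodule R R)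
      (q.asIdeal ⊔ IsLocalRing.maximalIdeal R ^ n) := by
    rw [Order.one_le_iff_ne_zero]
    refine relLength_ne_zero fun h => (IsLocalRing.maximalIdeal.isMaximal R).ne_top ?_
    refine top_unique (h.trans (sup_le (IsLocalRing.le_maximalIdeal q.isPrime.ne_top) ?_))
    exact Ideal.pow_le_self (by omega)
  induction d generalizing p with
  | zero => exact ⟨1, fun n hn => by simpa using hpos _ n hn⟩
  | succ d ih =>
    obtain ⟨c, hc⟩ := ih (fun i => p (i + 1)) fun i hi => hp (i + 1) (by omega)
    obtain ⟨x, hx1, hx0⟩ := SetLike.exists_of_lt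
      (show (p 0).asIdeal < (p 1).asIdeal from hp 0 (Nat.succ_pos d))
    obtain ⟨a', ha'⟩ := (p 0).isPrime.exists_mem_sup_pow_of_mul_mem hx0
      (IsLocalRing.maximalIdeal R)
    set a := a' + 1 with ha
    set m := IsLocalRing.maximalIdeal R
    have hstep (n : ℕ) : relLength (⊤ : Submodule R R) ((p 0).asIdeal ⊔ m ^ n) +
        relLength (⊤ : Submodule R R) ((p 1).asIdeal ⊔ m ^ (n + a)) ≤
        relLength (⊤ : Submodule R R) ((p 0).asIdeal ⊔ m ^ (n + a)) := by
      rw [relLength_add (C := (p 1).asIdeal ⊔ m ^ (n + a)) (sup_le_sup_right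
        (show (p 0).asIdeal < (p 1).asIdeal from hp 0 (Nat.succ_pos d)).le _) le_top]
      gcongr
      refine relLength_le_of_inj (LinearMap.lsmul R R x) ?_ ?_
      · exact fun r _ => Submodule.mem_sup_left (Ideal.mul_mem_right _ _ hx1)
      · exact fun r _ hr => ha' n r
          ((sup_le_sup_left (Ideal.pow_le_pow_right (by omega)) _ : _ ≤ _ ⊔ m ^ (n + a')) hr)
    refine ⟨a ^ (d + 1) + (d + 1) * a * c, fun n hn => ?_⟩
    clear hn
    induction n using Nat.strong_induction_on with
    | _ n ihn =>
    rcases lt_or_ge n a with hna | hna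
    · rcases Nat.eq_zero_or_pos n with rfl | hn
      · simp
      · calc ((n ^ (d + 1) : ℕ) : ℕ∞) ≤ ((a ^ (d + 1) + (d + 1) * a * c : ℕ) : ℕ∞) * 1 := by
              rw [mul_one]
              exact_mod_cast (Nat.pow_le_pow_left hna.le _).trans (Nat.le_add_right _ _)
          _ ≤ _ := by
              gcongr
              exact hpos _ n hn
    · obtain ⟨n, rfl⟩ := Nat.exists_eq_add_of_le' hna
      set K := a ^ (d + 1) + (d + 1) * a * c
      calc (((n + a) ^ (d + 1) : ℕ) : ℕ∞)
          ≤ ((n ^ (d + 1) + (d + 1) * a * (n + a) ^ d : ℕ) : ℕ∞) := by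
            exact_mod_cast Nat.add_pow_succ_le n a d
        _ = (n ^ (d + 1) : ℕ) + ((d + 1) * a : ℕ) * ((n + a) ^ d : ℕ) := by push_cast; rfl
        _ ≤ K * relLength (⊤ : Submodule R R) ((p 0).asIdeal ⊔ m ^ n) + ((d + 1) * a : ℕ) *
            (c * relLength (⊤ : Submodule R R) ((p 1).asIdeal ⊔ m ^ (n + a))) := by
            gcongr
            · exact ihn n (by omega)
            · exact hc (n + a) (by omega)
        _ ≤ K * relLength (⊤ : Submodule R R) ((p 0).asIdeal ⊔ m ^ n) +
            K * relLength (⊤ : Submodule R R) ((p 1).asIdeal ⊔ m ^ (n + a)) := by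
            rw [← mul_assoc, ← Nat.cast_mul]
            gcongr
            exact Nat.le_add_left _ _
        _ ≤ K * relLength (⊤ : Submodule R R) ((p 0).asIdeal ⊔ m ^ (n + a)) := by
            rw [← mul_add]
            gcongr
            exact hstep n

/-- The colengths of the powers of the maximal ideal grow at least like a polynomial of degree the
Krull dimension. -/
theorem exists_pow_le_mul_relLength [IsNoetherianRing R] [IsLocalRing R] {d : ℕ}
    (hd : ringKrullDim R = d) : ∃ c : ℕ, ∀ n : ℕ, 1 ≤ n →
      ((n ^ d : ℕ) : ℕ∞) ≤ c * relLength (⊤ : Submodule R R) (IsLocalRing.maximalIdeal R ^ n) := by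
  obtain ⟨l, hl⟩ := Order.le_krullDim_iff.1 hd.ge
  obtain ⟨c, hc⟩ := exists_pow_le_mul_relLength_of_chain d
    (fun i => l.toFun ⟨min i d, by omega⟩) fun i hi => l.strictMono (by
      rw [Fin.lt_def]
      simp only
      omega)
  refine ⟨c, fun n hn => (hc n hn).trans ?_⟩
  gcongr
  exact relLength_mono le_rfl le_sup_right

end HilbertSamuel

section Functional

variable {R I : Type*} [CommRing R] [IsLocalRing R]

theorem exists_surjective_residue {N : Type*} [AddCommGroup N] [Module R N] [Module.Finite R N]
    {B : Submodule R N} (hB : B ≠ ⊤) : ∃ μ : N →ₗ[R] R ⧸ IsLocalRing.maximalIdeal R,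
      Function.Surjective μ ∧ B ≤ LinearMap.ker μ := by
  obtain ⟨K, hK, hBK⟩ := (eq_top_or_exists_le_coatom B).resolve_left hB
  obtain ⟨J, hJ, ⟨e⟩⟩ := isSimpleModule_iff_quot_maximal.1 (isSimpleModule_iff_isCoatom.2 hK)
  obtain rfl := IsLocalRing.eq_maximalIdeal hJ
  exact ⟨e.toLinearMap ∘ₗ K.mkQ, e.surjective.comp K.mkQ_surjective, hBK.trans (by simp)⟩

/-- If some homology of the complex is nonzero, there are a degree `i`, a cycle `z` of degree `i` and
a functional `l` that vanishes on boundaries modulo the maximal ideal, whose value on `z` is a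
unit. -/
theorem IsGradedDiff.exists_functional [IsNoetherianRing R] [Fintype I] {deg : I → ℕ}
    {A : Matrix I I R} (hA : IsGradedDiff deg A)
    (hne : ∃ i, ¬ gradedCycles deg A R i ≤ gradedBoundaries deg A R i) :
    ∃ i, ∃ l z : I → R, z ∈ gradedCycles deg A R i ∧ IsUnit (∑ b, l b * z b) ∧
      ∀ c, ∑ b, l b * A b c ∈ IsLocalRing.maximalIdeal R := by
  classical
  obtain ⟨s, hs, hAs⟩ := hA.exists_homotopy 1 (Nat.find hne) fun j hj v hv => by
    rw [one_smul]
    exact not_not.1 (Nat.find_min hne hj) hv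
  have hi := Nat.find_spec hne
  set i := Nat.find hne
  obtain ⟨μ, hμ, hBμ⟩ := exists_surjective_residue
    (B := (gradedBoundaries deg A R i).submoduleOf (gradedCycles deg A R i))
    fun h => hi (Submodule.comap_subtype_eq_top.1 h)
  let h : (I → R) →ₗ[R] (I → R) :=
    LinearMap.pi fun a => if deg a = i then LinearMap.proj a else 0
  have hh (v : I → R) (a : I) : h v a = if deg a = i then v a else 0 := by
    simp only [h, LinearMap.pi_apply]
    split_ifs <;> rfl
  have hhom (v : I → R) : h v ∈ homogeneous R deg R i := fun a ha => by rw [hh, if_neg ha]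
  have hh_of_mem {v : I → R} (hv : v ∈ homogeneous R deg R i) : h v = v := by
    ext a
    rw [hh]
    split_ifs with ha
    · rfl
    · exact (hv a ha).symm
  have hcyc (v : I → R) : h v - s.act R (A.act R (h v)) ∈ gradedCycles deg A R i := by
    have hw {b : I} (hb : deg b + 1 ≠ i) : A.act R (h v) b = 0 := by
      rw [Matrix.act_apply]
      refine Finset.sum_eq_zero fun c _ => ?_
      by_cases hbc : A b c = 0
      · simp [hbc]
      · rw [hhom v c (by have := hA.deg_eq _ _ hbc; omega), smul_zero]
    refine ⟨Submodule.sub_mem _ (hhom v) fun a ha => ?_, ?_⟩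
    · rw [Matrix.act_apply]
      refine Finset.sum_eq_zero fun b _ => ?_
      by_cases hab : s a b = 0
      · simp [hab]
      · rw [hw (by have := hs _ _ hab; omega), smul_zero]
    · change A.act R (h v - s.act R (A.act R (h v))) = 0
      have h1 : (A * s + s * A).act R (A.act R (h v)) = A.act R (h v) := by
        ext a
        rw [Matrix.act_apply, Finset.sum_eq_single a]
        · by_cases ha : deg a + 1 = i
          · rw [hAs a (by omega), if_pos rfl, one_pow, one_smul]
          · rw [hw ha, smul_zero]
        · intro b _ hba
          by_cases hb : deg b + 1 = i
          · rw [hAs b (by omega), if_neg hba.symm, zero_smul]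
          · rw [hw hb, smul_zero]
        · simp
      rw [Matrix.act_add_apply, Matrix.act_mul_apply, Matrix.act_mul_apply, hA.act_act, map_zero,
        add_zero] at h1
      rw [map_sub, h1, sub_self]
  let pr : (I → R) →ₗ[R] gradedCycles deg A R i :=
    (h - s.act R ∘ₗ A.act R ∘ₗ h).codRestrict _ hcyc
  have hpr (v : I → R) (hv : v ∈ gradedCycles deg A R i) : pr v = ⟨v, hv⟩ := by
    refine Subtype.ext ?_
    change h v - s.act R (A.act R (h v)) = v
    rw [hh_of_mem hv.1, show A.act R v = 0 from hv.2, map_zero, sub_zero]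
  choose l hl using fun b => Ideal.Quotient.mk_surjective
    (μ (pr fun j => if b = j then 1 else 0))
  have key (v : I → R) : Ideal.Quotient.mk _ (∑ b, l b * v b) = μ (pr v) := by
    rw [← LinearMap.comp_apply, LinearMap.pi_apply_eq_sum_univ, map_sum]
    refine Finset.sum_congr rfl fun b _ => ?_
    rw [map_mul, hl, mul_comm, LinearMap.comp_apply, Algebra.smul_def]
    rfl
  obtain ⟨⟨z, hz⟩, hz1⟩ := hμ 1
  refine ⟨i, l, z, hz, ?_, fun c => ?_⟩
  · by_contra hu
    have := Ideal.Quotient.eq_zero_iff_mem.2 ((IsLocalRing.mem_maximalIdeal _).2 hu)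
    rw [key, hpr z hz, hz1] at this
    exact (IsLocalRing.maximalIdeal.isMaximal R).ne_top
      ((Ideal.eq_top_iff_one _).2 (Ideal.Quotient.eq_zero_iff_mem.1 this))
  · rw [← Ideal.Quotient.eq_zero_iff_mem, key]
    have hAc : (fun b => A b c) = A.act R (Pi.single c 1) := by
      ext b
      simp [Matrix.act_apply, Pi.single_apply]
    by_cases hc : deg c = i + 1
    · have hB : (fun b => A b c) ∈ gradedBoundaries deg A R i := by
        refine ⟨Pi.single c 1, fun a ha => ?_, hAc.symm⟩
        exact Pi.single_eq_of_ne (by rintro rfl; exact ha hc) _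
      rw [hpr _ (hA.boundaries_le_cycles i hB)]
      exact hBμ hB
    · have h0 : h (fun b => A b c) = 0 := by
        ext b
        rw [hh]
        split_ifs with hb
        · by_contra hbc
          exact hc (by rw [hA.deg_eq _ _ hbc, hb])
        · rfl
      have : pr (fun b => A b c) = 0 := by
        refine Subtype.ext ?_
        change h (fun b => A b c) - s.act R (A.act R (h fun b => A b c)) = 0
        simp [h0]
      rw [this, map_zero]

theorem exists_relLength_le_homologyLength_frobenius [CharP R 2] [IsNoetherianRing R] [Fintype I]
    {deg : I → ℕ} {A : Matrix I I R} (hA : IsGradedDiff deg A)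
    (hne : ∃ i, ¬ gradedCycles deg A R i ≤ gradedBoundaries deg A R i) :
    ∃ i, (∃ a, deg a = i) ∧ ∀ e : ℕ,
      relLength (⊤ : Submodule R R) (IsLocalRing.maximalIdeal R ^ 2 ^ e) ≤
        homologyLength deg (A.map (iterateFrobenius R 2 e)) R i := by
  obtain ⟨i, l, z, hz, hlz, hlA⟩ := hA.exists_functional hne
  refine ⟨i, ?_, fun e => ?_⟩
  · by_contra hi
    have : z = 0 := funext fun a => hz.1 a fun ha => hi ⟨a, ha⟩
    simp [this] at hlz
  set φ := iterateFrobenius R 2 e with hφ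
  let g : (I → R) →ₗ[R] R := Fintype.linearCombination R (fun b => φ (l b))
  have hg (v : I → R) : g v = ∑ b, φ (l b) * v b := by
    simp [g, Fintype.linearCombination_apply, mul_comm]
  refine relLength_le_of_surj g ?_ ?_
  · intro r _
    obtain ⟨u, hu⟩ := hlz.map φ
    refine ⟨(r * ↑u⁻¹) • fun b => φ (z b), Submodule.smul_mem _ _ ⟨fun a ha => ?_, ?_⟩, ?_⟩
    · simp [hz.1 a ha]
    · ext a
      have := congrArg φ (congrFun (show A.act R z = 0 from hz.2) a)
      simp only [Matrix.act_apply, smul_eq_mul, map_sum, map_mul, Pi.zero_apply, map_zero] at this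
      change (A.map φ).act R (fun b => φ (z b)) a = 0
      rw [Matrix.act_apply, ← this]
      rfl
    · have : g (fun b => φ (z b)) = u := by
        rw [hg, hu, map_sum]
        simp only [map_mul]
      rw [map_smul, this, smul_eq_mul, mul_assoc, Units.inv_mul, mul_one, sub_self]
      exact Submodule.zero_mem _
  · rintro _ - ⟨v, hv, rfl⟩
    have : g ((A.map φ).act R v) = ∑ c, φ (∑ b, l b * A b c) * v c := by
      simp only [hg, Matrix.act_apply, smul_eq_mul, Matrix.map_apply, map_sum, map_mul,
        Finset.mul_sum, Finset.sum_mul, mul_assoc]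
      exact Finset.sum_comm
    rw [this]
    refine Ideal.sum_mem _ fun c _ => Ideal.mul_mem_right _ _ ?_
    rw [hφ, iterateFrobenius_def]
    exact Ideal.pow_mem_pow (hlA c) _

end Functional

section RankBound

theorem two_pow_le_of_growth {α : ℕ → ℕ} {r d D C c : ℕ}
    (hα : ∀ e, α (e + 1) ≤ r * α e + D * (2 ^ e) ^ d)
    (hc : ∀ e, (2 ^ e) ^ (d + 1) ≤ c * (α e + C * (2 ^ e) ^ d)) : 2 ^ (d + 1) ≤ r := by
  by_contra! hr
  set σ : ℝ := 2 ^ (d + 1) - 1 / 2 with hσ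
  have hrσ : (r : ℝ) + 1 / 2 ≤ σ := by
    have : (r : ℝ) + 1 ≤ 2 ^ (d + 1) := by exact_mod_cast hr
    linarith
  have hdσ : (2 : ℝ) ^ d ≤ σ := by
    have : (1 : ℝ) ≤ 2 ^ d := one_le_pow₀ one_le_two
    rw [hσ, pow_succ]
    linarith
  have hσ0 : 0 < σ := lt_of_lt_of_le (by positivity) hdσ
  have hpow (e : ℕ) : ((2 : ℝ) ^ e) ^ d ≤ σ ^ e := by
    rw [← pow_mul, mul_comm, pow_mul]
    gcongr
  have hbound (e : ℕ) : (α e : ℝ) ≤ (α 0 + 2 * D) * σ ^ e := by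
    induction e with
    | zero => simp
    | succ e ih =>
      calc (α (e + 1) : ℝ) ≤ r * α e + D * (2 ^ e) ^ d := by exact_mod_cast hα e
        _ ≤ r * ((α 0 + 2 * D) * σ ^ e) + D * σ ^ e := by
            gcongr
            exact hpow e
        _ ≤ r * ((α 0 + 2 * D) * σ ^ e) + (α 0 + 2 * D) * σ ^ e * (1 / 2) := by
            have : (0 : ℝ) ≤ α 0 * σ ^ e := by positivity
            linarith
        _ = (r + 1 / 2) * ((α 0 + 2 * D) * σ ^ e) := by ring
        _ ≤ σ * ((α 0 + 2 * D) * σ ^ e) := by gcongr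
        _ = _ := by ring
  obtain ⟨e, he⟩ := pow_unbounded_of_one_lt (c * (α 0 + 2 * D + C) : ℝ)
    (show 1 < 2 ^ (d + 1) / σ by rw [one_lt_div hσ0]; linarith)
  rw [div_pow, lt_div_iff₀ (by positivity)] at he
  refine he.not_ge ?_
  calc ((2 : ℝ) ^ (d + 1)) ^ e = (2 ^ e) ^ (d + 1) := by rw [← pow_mul, mul_comm, pow_mul]
    _ ≤ c * (α e + C * (2 ^ e) ^ d) := by exact_mod_cast hc e
    _ ≤ c * ((α 0 + 2 * D) * σ ^ e + C * σ ^ e) := by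
        gcongr
        · exact hbound e
        · exact hpow e
    _ = _ := by ring

universe u

variable {R : Type u} {I : Type*} [CommRing R] [Fintype I] {deg : I → ℕ} {A : Matrix I I R}

omit [Fintype I] in
theorem Matrix.map_iterateFrobenius_map_frobenius [CharP R 2] (A : Matrix I I R) (e : ℕ) :
    (A.map (iterateFrobenius R 2 e)).map (frobenius R 2) =
      A.map (iterateFrobenius R 2 (e + 1)) := by
  ext a b
  simp [iterateFrobenius_def, frobenius_def, pow_succ, pow_mul]

/-- The rank bound, for the matrix of the differential in a homogeneous basis. -/
theorem IsGradedDiff.two_pow_le_card [IsNoetherianRing R] [IsLocalRing R] [CharP R 2]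
    (hA : IsGradedDiff deg A) {d : ℕ} (hd : ringKrullDim R = d) (hn : ∀ a, deg a ≤ d + 1)
    (hx : ∀ x ∈ IsLocalRing.maximalIdeal R, ∃ c : ℕ, ∀ k, ∀ v ∈ gradedCycles deg A R k,
      x ^ c • v ∈ gradedBoundaries deg A R k)
    (hne : ∃ i, ¬ gradedCycles deg A R i ≤ gradedBoundaries deg A R i) :
    2 ^ d ≤ Fintype.card I := by
  classical
  obtain ⟨i, ⟨a₀, ha₀⟩, hi⟩ := exists_relLength_le_homologyLength_frobenius hA hne
  obtain _ | d := d
  · exact Fintype.card_pos_iff.2 ⟨a₀⟩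
  obtain ⟨c, hc⟩ := exists_pow_le_mul_relLength hd
  obtain ⟨C, hC⟩ := hA.exists_homologyLength_frobenius_le hn hx d R
  obtain ⟨C', hC'⟩ := hA.exists_homologyLength_frobenius_le hn hx (d + 1 + 1) R
  have hfin (e k : ℕ) : ∃ m : ℕ,
      homologyLength deg (A.map (iterateFrobenius R 2 e)) R k = m := by
    refine ENat.ne_top_iff_exists.1 (ne_top_of_le_ne_top ?_ (hC' e k (by omega))) |>.imp
      fun _ h => h.symm
    exact_mod_cast ENat.natCast_ne_top (C' * (2 ^ e) ^ (d + 1 + 1))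
  choose H hH using hfin
  have hHC (e k : ℕ) (hk : 2 ≤ k) : H e k ≤ C * (2 ^ e) ^ d := by
    have := hC e k (by omega)
    rw [hH] at this
    exact_mod_cast this
  have hHi (e : ℕ) : H e i ≤ H e 0 + H e 1 + C * (2 ^ e) ^ d := by
    obtain rfl | rfl | h : i = 0 ∨ i = 1 ∨ 2 ≤ i := by omega
    · omega
    · omega
    · have := hHC e i h
      omega
  refine two_pow_le_of_growth (α := fun e => H e 0 + H e 1) (C := C) (c := c)
    (D := 2 * ((d + 2) * (C * 2 ^ d)) + Fintype.card I * ((d + 1) * C)) (fun e => ?_) fun e => ?_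
  · have h1 := homologyLength_zero_add_one_le (hA.map (iterateFrobenius R 2 e)) hn
    have h2 := relLength_twistedDiff_le (hA.map (iterateFrobenius R 2 e)) hn
    simp only [Matrix.map_iterateFrobenius_map_frobenius] at h1
    have h3 := h1.trans (add_le_add_right h2 _)
    simp only [hH] at h3
    norm_cast at h3
    have hsum (f : ℕ → ℕ) (e m : ℕ) (hf : ∀ w, 2 ≤ f w) :
        ∑ w ∈ Finset.range m, H e (f w) ≤ m * (C * (2 ^ e) ^ d) := by
      simpa using Finset.sum_le_card_nsmul (Finset.range m) (fun w => H e (f w)) _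
        fun w _ => hHC e _ (hf w)
    have h4 := hsum (fun w => 2 + w) (e + 1) (d + 1 + 1) fun w => Nat.le_add_right _ _
    have h5 := hsum (fun w => 3 + w) (e + 1) (d + 1 + 1) fun w => by omega
    have h6 := hsum (fun w => w + 1 + 1) e (d + 1) fun w => by omega
    have h7 : ∑ q ∈ Finset.range (d + 1 + 1 + 1), H e q ≤
        H e 0 + H e 1 + (d + 1) * (C * (2 ^ e) ^ d) := by
      rw [Finset.sum_range_succ', Finset.sum_range_succ', zero_add]
      omega
    calc H (e + 1) 0 + H (e + 1) 1 ≤ (d + 1 + 1) * (C * (2 ^ (e + 1)) ^ d) +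
          (d + 1 + 1) * (C * (2 ^ (e + 1)) ^ d) +
          Fintype.card I * (H e 0 + H e 1 + (d + 1) * (C * (2 ^ e) ^ d)) :=
          h3.trans (add_le_add (add_le_add h4 h5) (Nat.mul_le_mul_left _ h7))
      _ = _ := by ring
  · have h1 := (hc (2 ^ e) Nat.one_le_two_pow).trans (mul_le_mul_right (hi e) _)
    rw [hH] at h1
    norm_cast at h1
    exact h1.trans (Nat.mul_le_mul_left _ (hHi e))

end RankBound

section ChainComplexTranslation

theorem IsFiniteLength.exists_pow_smul_eq_zero {R M : Type*} [CommRing R] [IsLocalRing R]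
    [AddCommGroup M] [Module R M] (h : IsFiniteLength R M) {x : R}
    (hx : x ∈ IsLocalRing.maximalIdeal R) : ∃ c : ℕ, ∀ m : M, x ^ c • m = 0 := by
  induction h with
  | of_subsingleton => exact ⟨0, fun m => Subsingleton.elim _ _⟩
  | @of_simple_quotient M _ _ N hs _ ih =>
    obtain ⟨c, hc⟩ := ih
    obtain ⟨J, hJ, ⟨e⟩⟩ := isSimpleModule_iff_quot_maximal.1 hs
    obtain rfl := IsLocalRing.eq_maximalIdeal hJ
    refine ⟨c + 1, fun m => ?_⟩
    have hxm : x • m ∈ N := by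
      rw [← Submodule.Quotient.mk_eq_zero, Submodule.Quotient.mk_smul]
      apply e.injective
      rw [map_smul, map_zero, Algebra.smul_def]
      rw [show algebraMap R (R ⧸ IsLocalRing.maximalIdeal R) x = 0 from
        Ideal.Quotient.eq_zero_iff_mem.2 hx, zero_mul]
    have := congrArg Subtype.val (hc ⟨x • m, hxm⟩)
    rwa [Submodule.coe_smul, smul_smul, ← pow_succ] at this

variable {R : Type} [CommRing R] (P : ChainComplex (ModuleCat R) ℕ)

/-- Cycles of degree `k`. -/
def chainCycles (k : ℕ) : Submodule R (P.X k) := ⨅ j, LinearMap.ker (P.d k j).hom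

/-- Boundaries of degree `k`, as a submodule of the cycles. -/
def chainBoundaries (k : ℕ) : Submodule R (chainCycles P k) :=
  (LinearMap.range (P.d (k + 1) k).hom).submoduleOf (chainCycles P k)

theorem mem_chainCycles {k : ℕ} {z : P.X k} :
    z ∈ chainCycles P k ↔ ∀ j, (P.d k j).hom z = 0 := by
  simp [chainCycles]

theorem mem_chainBoundaries {k : ℕ} {z : chainCycles P k} :
    z ∈ chainBoundaries P k ↔ ∃ u, (P.d (k + 1) k).hom u = z := Iff.rfl

theorem ker_sc_g (k : ℕ) : LinearMap.ker (P.sc k).g.hom = chainCycles P k := by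
  ext z
  refine Iff.trans ?_ (mem_chainCycles P).symm
  refine ⟨fun h j => ?_, fun h => h _⟩
  by_cases hj : (ComplexShape.down ℕ).Rel k j
  · obtain rfl := (ComplexShape.down ℕ).next_eq' hj
    exact h
  · rw [P.shape k j hj]
    rfl

theorem range_sc_f (k : ℕ) :
    LinearMap.range (P.sc k).f.hom = LinearMap.range (P.d (k + 1) k).hom := by
  have key (j : ℕ) (hj : j = k + 1) :
      LinearMap.range (P.d j k).hom = LinearMap.range (P.d (k + 1) k).hom := by rw [hj]
  exact key _ (ChainComplex.prev ℕ k)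

theorem nonempty_homology_equiv (k : ℕ) :
    Nonempty (P.homology k ≃ₗ[R] (chainCycles P k ⧸ chainBoundaries P k)) := by
  refine ⟨(P.sc k).moduleCatHomologyIso.toLinearEquiv ≪≫ₗ
    Submodule.Quotient.equiv _ _ (LinearEquiv.ofEq _ _ (ker_sc_g P k)) ?_⟩
  ext z
  rw [Submodule.mem_map, mem_chainBoundaries, ← LinearMap.mem_range, ← range_sc_f]
  constructor
  · rintro ⟨_, ⟨u, rfl⟩, rfl⟩
    exact ⟨u, rfl⟩
  · rintro ⟨u, hu⟩
    exact ⟨(P.sc k).moduleCatToCycles u, ⟨u, rfl⟩, Subtype.ext hu⟩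

theorem exists_pow_smul_eq_d [IsLocalRing R] {k : ℕ} (h : IsFiniteLength R (P.homology k)) {x : R}
    (hx : x ∈ IsLocalRing.maximalIdeal R) :
    ∃ c : ℕ, ∀ z ∈ chainCycles P k, ∃ u, (P.d (k + 1) k).hom u = x ^ c • z := by
  obtain ⟨e⟩ := nonempty_homology_equiv P k
  obtain ⟨c, hc⟩ := (e.isFiniteLength h).exists_pow_smul_eq_zero hx
  exact ⟨c, fun z hz => (Submodule.Quotient.mk_eq_zero (chainBoundaries P k)).1
    (hc (Submodule.Quotient.mk ⟨z, hz⟩))⟩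

theorem exists_cycle_of_nontrivial_homology {k : ℕ} (h : Nontrivial (P.homology k)) :
    ∃ z ∈ chainCycles P k, ∀ u, (P.d (k + 1) k).hom u ≠ z := by
  obtain ⟨e⟩ := nonempty_homology_equiv P k
  by_contra! H
  have := e.symm.nontrivial
  refine not_subsingleton (chainCycles P k ⧸ chainBoundaries P k)
    (Submodule.Quotient.subsingleton_iff.2 (eq_top_iff.2 fun z _ => H z z.2))

variable {n : ℕ} {ι : Fin n → Type} [∀ j, Fintype (ι j)]

/-- The total differential of a chain complex, in degrees less than `n`. -/
def totalDiff (n : ℕ) : (∀ j : Fin n, P.X j) →ₗ[R] (∀ j : Fin n, P.X j) :=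
  LinearMap.pi fun i => ∑ j : Fin n, (P.d j i).hom ∘ₗ LinearMap.proj j

theorem totalDiff_apply (x : ∀ j : Fin n, P.X j) (i : Fin n) :
    totalDiff P n x i = ∑ j : Fin n, (P.d j i).hom (x j) := by
  simp [totalDiff]

theorem totalDiff_single (j : Fin n) (z : P.X j) (i : Fin n) :
    totalDiff P n (Pi.single j z) i = (P.d j i).hom z := by
  rw [totalDiff_apply, Finset.sum_eq_single j]
  · rw [Pi.single_eq_same]
  · intro l _ hl
    rw [Pi.single_eq_of_ne hl, map_zero]
  · simp

theorem totalDiff_totalDiff (x : ∀ j : Fin n, P.X j) : totalDiff P n (totalDiff P n x) = 0 := by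
  ext i
  simp only [totalDiff_apply, map_sum]
  refine Finset.sum_eq_zero fun j _ => Finset.sum_eq_zero fun l _ => ?_
  rw [← LinearMap.comp_apply, ← ModuleCat.hom_comp, P.d_comp_d]
  rfl

variable [∀ j, DecidableEq (ι j)] (b : ∀ j : Fin n, Module.Basis (ι j) R (P.X j))

/-- The matrix of the total differential. -/
noncomputable def totalMatrix : Matrix (Σ j, ι j) (Σ j, ι j) R :=
  LinearMap.toMatrix (Pi.basis b) (Pi.basis b) (totalDiff P n)

theorem totalMatrix_act (v : (Σ j, ι j) → R) :
    (totalMatrix P b).act R v =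
      (Pi.basis b).equivFun (totalDiff P n ((Pi.basis b).equivFun.symm v)) := by
  ext a
  rw [Matrix.act_apply]
  have := congrFun (LinearMap.toMatrix_mulVec_repr (Pi.basis b) (Pi.basis b) (totalDiff P n)
    ((Pi.basis b).equivFun.symm v)) a
  rw [Module.Basis.equivFun_apply, ← this]
  simp only [Matrix.mulVec, dotProduct]
  refine Finset.sum_congr rfl fun c _ => ?_
  rw [← Module.Basis.equivFun_apply, LinearEquiv.apply_symm_apply]
  rfl

theorem isGradedDiff_totalMatrix :
    IsGradedDiff (fun a : Σ j, ι j => (a.1 : ℕ)) (totalMatrix P b) where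
  sq := by
    rw [totalMatrix, ← LinearMap.toMatrix_comp,
      show totalDiff P n ∘ₗ totalDiff P n = 0 from LinearMap.ext (totalDiff_totalDiff P), map_zero]
  deg_eq a c h := by
    by_contra hac
    refine h ?_
    rw [totalMatrix, LinearMap.toMatrix_apply, Pi.basis_repr, Pi.basis_apply, totalDiff_single,
      P.shape _ _ fun h' => hac h'.symm]
    simp

omit [∀ j, DecidableEq (ι j)] in
theorem mem_homogeneous_iff {k : ℕ} {v : (Σ j, ι j) → R} :
    v ∈ homogeneous R (fun a : Σ j, ι j => (a.1 : ℕ)) R k ↔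
      ∀ j : Fin n, (j : ℕ) ≠ k → (Pi.basis b).equivFun.symm v j = 0 := by
  obtain ⟨x, rfl⟩ := (Pi.basis b).equivFun.surjective v
  rw [LinearEquiv.symm_apply_apply]
  constructor
  · intro h j hj
    refine (b j).ext_elem fun i => ?_
    have := h ⟨j, i⟩ hj
    rw [Module.Basis.equivFun_apply, Pi.basis_repr] at this
    rw [this, map_zero]
    rfl
  · intro h a ha
    rw [Module.Basis.equivFun_apply, Pi.basis_repr, h _ ha, map_zero]
    rfl

omit [∀ j, DecidableEq (ι j)] in
theorem equivFun_single_mem_homogeneous (k : Fin n) (z : P.X k) :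
    (Pi.basis b).equivFun (Pi.single k z) ∈
      homogeneous R (fun a : Σ j, ι j => (a.1 : ℕ)) R (k : ℕ) := by
  rw [mem_homogeneous_iff]
  intro j hj
  rw [LinearEquiv.symm_apply_apply, Pi.single_eq_of_ne fun h => hj (by rw [h])]

omit [∀ j, DecidableEq (ι j)] in
theorem exists_eq_equivFun_single {k : Fin n} {v : (Σ j, ι j) → R}
    (hv : v ∈ homogeneous R (fun a : Σ j, ι j => (a.1 : ℕ)) R (k : ℕ)) :
    ∃ z, (Pi.basis b).equivFun (Pi.single k z) = v := by
  rw [mem_homogeneous_iff P b] at hv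
  refine ⟨(Pi.basis b).equivFun.symm v k, ?_⟩
  rw [← LinearEquiv.eq_symm_apply]
  ext j
  by_cases hj : j = k
  · subst hj
    rw [Pi.single_eq_same]
  · rw [Pi.single_eq_of_ne hj, hv j fun h => hj (Fin.ext h)]

theorem totalMatrix_act_single (k : Fin n) (z : P.X k) :
    (totalMatrix P b).act R ((Pi.basis b).equivFun (Pi.single k z)) =
      (Pi.basis b).equivFun fun i => (P.d k i).hom z := by
  rw [totalMatrix_act, LinearEquiv.symm_apply_apply]
  congr 1
  ext i
  rw [totalDiff_single]

theorem equivFun_single_mem_gradedCycles_iff (k : Fin n) (z : P.X k) :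
    (Pi.basis b).equivFun (Pi.single k z) ∈
      gradedCycles (fun a : Σ j, ι j => (a.1 : ℕ)) (totalMatrix P b) R (k : ℕ) ↔
      z ∈ chainCycles P k := by
  have h : (Pi.basis b).equivFun (Pi.single k z) ∈
      gradedCycles (fun a : Σ j, ι j => (a.1 : ℕ)) (totalMatrix P b) R (k : ℕ) ↔
      (totalMatrix P b).act R ((Pi.basis b).equivFun (Pi.single k z)) = 0 :=
    ⟨fun h => h.2, fun h => ⟨equivFun_single_mem_homogeneous P b k z, h⟩⟩
  rw [h, totalMatrix_act_single, LinearEquiv.map_eq_zero_iff, mem_chainCycles]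
  refine ⟨fun h j => ?_, fun h => funext fun i => h i⟩
  by_cases hj : j + 1 = (k : ℕ)
  · exact congrFun h ⟨j, by omega⟩
  · rw [P.shape _ _ hj]
    rfl

theorem equivFun_single_mem_gradedBoundaries_iff (hP : ∀ j, n ≤ j → Subsingleton (P.X j))
    (k : Fin n) (z : P.X k) :
    (Pi.basis b).equivFun (Pi.single k z) ∈
      gradedBoundaries (fun a : Σ j, ι j => (a.1 : ℕ)) (totalMatrix P b) R (k : ℕ) ↔
      ∃ u, (P.d (k + 1) k).hom u = z := by
  constructor
  · rintro ⟨w, hw, hwz⟩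
    by_cases hk : (k : ℕ) + 1 < n
    · obtain ⟨u, rfl⟩ := exists_eq_equivFun_single P b (k := ⟨k + 1, hk⟩) hw
      rw [totalMatrix_act_single, EmbeddingLike.apply_eq_iff_eq] at hwz
      have := congrFun hwz k
      rw [Pi.single_eq_same] at this
      exact ⟨u, this⟩
    · have hw0 : w = 0 := funext fun a => hw a (by have := a.1.2; dsimp only; omega)
      rw [hw0, map_zero, eq_comm, LinearEquiv.map_eq_zero_iff, Pi.single_eq_zero_iff] at hwz
      exact ⟨0, by rw [map_zero, hwz]⟩
  · rintro ⟨u, rfl⟩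
    by_cases hk : (k : ℕ) + 1 < n
    · refine ⟨_, equivFun_single_mem_homogeneous P b ⟨k + 1, hk⟩ u, ?_⟩
      rw [totalMatrix_act_single]
      congr 1
      ext i
      by_cases hi : i = k
      · subst hi
        rw [Pi.single_eq_same]
      · rw [Pi.single_eq_of_ne hi, P.shape]
        · rfl
        · exact fun h => hi (Fin.ext (by simpa using h))
    · have := hP (k + 1) (by omega)
      rw [Subsingleton.elim u 0, map_zero, Pi.single_zero, map_zero]
      exact Submodule.zero_mem _

end ChainComplexTranslation

/-- Let `(R, m, k)` be a Noetherian local ring of characteristic `2` and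
Krull dimension `d`, and let `P` be a complex of finite rank free `R`-modules concentrated
in homological degrees `0, …, d+1` whose homology is of finite length in every degree and
nonzero in some degree.  Then `∑_{j=0}^{d+1} rank_R(P_j) ≥ 2^d`. -/
theorem stmt0 (R : Type) [CommRing R] [IsNoetherianRing R] [IsLocalRing R] [CharP R 2]
    (d : ℕ) (hdim : ringKrullDim R = d)
    (P : ChainComplex (ModuleCat R) ℕ)
    (hfree : ∀ j, Module.Free R (P.X j))
    (hfin : ∀ j, Module.Finite R (P.X j))
    (hconc : ∀ j, d + 1 < j → Subsingleton (P.X j))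
    (hfl : ∀ i, IsFiniteLength R (P.homology i))
    (hne : ∃ i, Nontrivial (P.homology i)) :
    2 ^ d ≤ ∑ j ∈ Finset.range (d + 2), Module.finrank R (P.X j) := by
  classical
  let b (j : Fin (d + 2)) : Module.Basis (Fin (Module.finrank R (P.X j))) R (P.X j) :=
    Module.finBasis R (P.X j)
  have hcard : Fintype.card (Σ j : Fin (d + 2), Fin (Module.finrank R (P.X j))) =
      ∑ j ∈ Finset.range (d + 2), Module.finrank R (P.X j) := by
    rw [Fintype.card_sigma, ← Fin.sum_univ_eq_sum_range]
    simp
  rw [← hcard]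
  refine (isGradedDiff_totalMatrix P b).two_pow_le_card hdim (fun a => by have := a.1.2; omega)
    (fun x hx => ?_) ?_
  · choose c hc using fun k => exists_pow_smul_eq_d P (hfl k) hx
    refine ⟨∑ k ∈ Finset.range (d + 2), c k, fun k v hv => ?_⟩
    by_cases hk : k < d + 2
    · obtain ⟨z, rfl⟩ := exists_eq_equivFun_single P b (k := ⟨k, hk⟩) hv.1
      obtain ⟨u, hu⟩ := hc k z ((equivFun_single_mem_gradedCycles_iff P b ⟨k, hk⟩ z).1 hv)
      rw [← Nat.sub_add_cancel (Finset.single_le_sum_of_canonicallyOrdered (f := c)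
        (Finset.mem_range.2 hk)), pow_add, mul_smul, ← map_smul _ (x ^ c k), ← Pi.single_smul]
      exact Submodule.smul_mem _ _ ((equivFun_single_mem_gradedBoundaries_iff P b
        (fun j hj => hconc j hj) ⟨k, hk⟩ _).2 ⟨u, hu⟩)
    · have : v = 0 := funext fun a => hv.1 a (by have := a.1.2; dsimp only; omega)
      rw [this, smul_zero]
      exact Submodule.zero_mem _
  · obtain ⟨i, hi⟩ := hne
    obtain ⟨z, hz, hzu⟩ := exists_cycle_of_nontrivial_homology P hi
    have hid : i < d + 2 := by
      by_contra h
      have := hconc i (by omega)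
      exact hzu 0 (Subsingleton.elim _ _)
    refine ⟨i, fun h => ?_⟩
    obtain ⟨u, hu⟩ := (equivFun_single_mem_gradedBoundaries_iff P b (fun j hj => hconc j hj)
      ⟨i, hid⟩ z).1 (h ((equivFun_single_mem_gradedCycles_iff P b ⟨i, hid⟩ z).2 hz))
    exact hzu u hu
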